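/- Let P and Q be probability distributions on finite sets, neither of which is a uniform distribution (so V(P) > 0 and V(Q) > 0), suppose H(P)/V(P) < H(Q)/V(Q), let b ∈ ℝ, and let β be the unique real solution of N_P(x)/N_{P,Q,b}(x) = (1 − G_P(x))/(1 − G_{P,Q,b}(x)). Then lim_{n→∞} F^D(P^n → Q^{⌊(H(P)/H(Q))n + b√n⌋}) = lim_{n→∞} F^M(P^n → Q^{⌊(H(P)/H(Q))n + b√n⌋}) = I_{P,Q,b}(β) + √((1 − G_P(β))·(1 − G_{P,Q,b}(β))) (in particular both limits exist). -/

import Mathlib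

open MeasureTheory Filter

namespace RNG

variable {α β : Type*}

/-- `P` is a probability distribution on the finite set `α`. -/
def IsProb [Fintype α] (P : α → ℝ) : Prop :=
  (∀ x, 0 ≤ P x) ∧ ∑ x, P x = 1

open Classical in
/-- Pushforward distribution `W(P)(y) = ∑_{x : W x = y} P x`. -/
noncomputable def push [Fintype α] (W : α → β) (P : α → ℝ) : β → ℝ :=
  fun y => ∑ x, if W x = y then P x else 0

/-- Fidelity (Bhattacharyya coefficient) between distributions on the same finite set. -/
noncomputable def fid [Fintype β] (R S : β → ℝ) : ℝ :=
  ∑ y, Real.sqrt (R y * S y)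

/-- Sum of the `l` largest values of `P`, i.e. the `l`-th partial sum of the
decreasing rearrangement of `P` (padded with zeros). -/
noncomputable def topSum [Fintype α] (P : α → ℝ) (l : ℕ) : ℝ :=
  sSup {s : ℝ | ∃ A : Finset α, A.card ≤ l ∧ s = ∑ x ∈ A, P x}

/-- Majorization `P ≺ P'` (the distributions may live on different finite sets). -/
def Maj [Fintype α] [Fintype β] (P : α → ℝ) (P' : β → ℝ) : Prop :=
  ∀ l : ℕ, topSum P l ≤ topSum P' l

/-- Maximal fidelity under deterministic transformations,
`F^D(P → Q) = max {F(W(P), Q) | W : α → β}`. -/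
noncomputable def FD [Fintype α] [Fintype β] (P : α → ℝ) (Q : β → ℝ) : ℝ :=
  sSup {r : ℝ | ∃ W : α → β, r = fid (push W P) Q}

/-- Maximal fidelity under the majorization condition,
`F^M(P → Q) = max {F(P', Q) | P ≺ P', P'` a distribution on the target set`}`. -/
noncomputable def FM [Fintype α] [Fintype β] (P : α → ℝ) (Q : β → ℝ) : ℝ :=
  sSup {r : ℝ | ∃ P' : β → ℝ, IsProb P' ∧ Maj P P' ∧ r = fid P' Q}

/-- Shannon entropy (natural logarithm). -/
noncomputable def H [Fintype α] (P : α → ℝ) : ℝ := ∑ x, -(P x * Real.log (P x))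

/-- Varentropy `V(P)` (natural logarithm). -/
noncomputable def V [Fintype α] (P : α → ℝ) : ℝ :=
  ∑ x, P x * (-Real.log (P x) - H P) ^ 2

/-- Shannon entropy, base-2 logarithm. -/
noncomputable def H2 [Fintype α] (P : α → ℝ) : ℝ := ∑ x, -(P x * Real.logb 2 (P x))

/-- Varentropy, base-2 logarithm. -/
noncomputable def V2 [Fintype α] (P : α → ℝ) : ℝ :=
  ∑ x, P x * (-Real.logb 2 (P x) - H2 P) ^ 2

/-- The `n`-fold i.i.d. product distribution `P^n`. -/
noncomputable def iid [Fintype α] (P : α → ℝ) (n : ℕ) : (Fin n → α) → ℝ :=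
  fun f => ∏ i, P (f i)

/-- The uniform distribution on a two-element set. -/
noncomputable def U2 : Fin 2 → ℝ := fun _ => 1 / 2

/-- Density of the normal distribution `N(m, v)`. -/
noncomputable def normalPDF (m v t : ℝ) : ℝ :=
  (Real.sqrt (2 * Real.pi * v))⁻¹ * Real.exp (-(t - m) ^ 2 / (2 * v))

/-- Standard normal cumulative distribution function `G`. -/
noncomputable def stdG (x : ℝ) : ℝ := ∫ t in Set.Iic x, normalPDF 0 1 t

/-- Density `N_P` of `N(0, V(P))`. -/
noncomputable def NP [Fintype α] (P : α → ℝ) (x : ℝ) : ℝ := normalPDF 0 (V P) x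

/-- Density `N_{P,Q,b}` of `N(H(Q)b, (H(P)/H(Q))·V(Q))`. -/
noncomputable def NPQ [Fintype α] [Fintype β] (P : α → ℝ) (Q : β → ℝ) (b x : ℝ) : ℝ :=
  normalPDF (H Q * b) (H P / H Q * V Q) x

/-- Cdf `G_P(x) = G(x/√V(P))`. -/
noncomputable def GP [Fintype α] (P : α → ℝ) (x : ℝ) : ℝ := stdG (x / Real.sqrt (V P))

/-- Cdf `G_{P,Q,b}(x) = G(√(H(Q)/(H(P)V(Q)))·(x − H(Q)b))`. -/
noncomputable def GPQ [Fintype α] [Fintype β] (P : α → ℝ) (Q : β → ℝ) (b x : ℝ) : ℝ :=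
  stdG (Real.sqrt (H Q / (H P * V Q)) * (x - H Q * b))

/-- `I_{P,Q,b}(x) = ∫_{−∞}^x √(N_P(t) N_{P,Q,b}(t)) dt`. -/
noncomputable def IPQ [Fintype α] [Fintype β] (P : α → ℝ) (Q : β → ℝ) (b x : ℝ) : ℝ :=
  ∫ t in Set.Iic x, Real.sqrt (NP P t * NPQ P Q b t)

/-- `I_{P,Q,b}(∞) = ∫_ℝ √(N_P(t) N_{P,Q,b}(t)) dt`. -/
noncomputable def IPQinf [Fintype α] [Fintype β] (P : α → ℝ) (Q : β → ℝ) (b : ℝ) : ℝ :=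
  ∫ t : ℝ, Real.sqrt (NP P t * NPQ P Q b t)

/-- `L^D_n(P,Q|ν)`: the maximal `L` with `F^D(P^n → Q^L) ≥ ν`. -/
noncomputable def LD [Fintype α] [Fintype β] (P : α → ℝ) (Q : β → ℝ) (ν : ℝ) (n : ℕ) : ℕ :=
  sSup {L : ℕ | ν ≤ FD (iid P n) (iid Q L)}

/-- The optimal second order rate `R^D_2(P,Q|ν)`. -/
noncomputable def RD2 [Fintype α] [Fintype β] (P : α → ℝ) (Q : β → ℝ) (ν : ℝ) : ℝ :=
  sSup {b : ℝ | ∃ c : ℝ, ν ≤ c ∧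
    Tendsto (fun n : ℕ =>
      FD (iid P n) (iid Q (⌊H P / H Q * n + b * Real.sqrt n⌋₊))) atTop (nhds c)}

lemma IsProb.nonempty [Fintype α] {P : α → ℝ} (hP : IsProb P) : Nonempty α := by
  by_contra h
  rw [not_nonempty_iff] at h
  have := hP.2
  simp at this

lemma isProb_iid [Fintype α] {P : α → ℝ} (hP : IsProb P) (n : ℕ) : IsProb (iid P n) := by
  refine ⟨fun f => Finset.prod_nonneg fun i _ => hP.1 _, ?_⟩
  classical
  have := Finset.sum_prod_piFinset (Finset.univ : Finset α) (fun (_ : Fin n) x => P x)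
  simp only [Fintype.piFinset_univ] at this
  simp only [iid, this, hP.2, Finset.prod_const_one]

lemma isProb_push [Fintype α] [Fintype β] {P : α → ℝ} (hP : IsProb P) (W : α → β) :
    IsProb (push W P) := by
  classical
  refine ⟨fun y => Finset.sum_nonneg fun x _ => ?_, ?_⟩
  · split_ifs
    exacts [hP.1 x, le_rfl]
  · unfold push
    rw [Finset.sum_comm]
    simpa using hP.2

lemma sum_le_sum_push_image [Fintype α] [Fintype β] [DecidableEq β] {P : α → ℝ}
    (hP : ∀ x, 0 ≤ P x) (W : α → β) (A : Finset α) :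
    ∑ x ∈ A, P x ≤ ∑ y ∈ A.image W, push W P y := by
  unfold push
  rw [Finset.sum_comm]
  calc ∑ x ∈ A, P x ≤ ∑ x ∈ A, ∑ y ∈ A.image W, if W x = y then P x else 0 := by
        refine Finset.sum_le_sum fun x hx => ?_
        rw [Finset.sum_ite_eq, if_pos (Finset.mem_image_of_mem W hx)]
    _ ≤ _ := by
        refine (Finset.sum_le_sum_of_subset_of_nonneg (Finset.subset_univ A) ?_).trans
          (le_of_eq (by congr!))
        intro x _ _
        refine Finset.sum_nonneg fun y _ => ?_
        split_ifs
        exacts [hP x, le_rfl]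

lemma fid_le_one [Fintype β] {R S : β → ℝ} (hR : IsProb R) (hS : IsProb S) : fid R S ≤ 1 := by
  calc fid R S ≤ ∑ y, (R y + S y) / 2 := by
        refine Finset.sum_le_sum fun y _ => ?_
        rw [Real.sqrt_le_left (by linarith [hR.1 y, hS.1 y])]
        nlinarith [sq_nonneg (R y - S y)]
    _ = 1 := by
        rw [← Finset.sum_div, Finset.sum_add_distrib, hR.2, hS.2]
        norm_num

lemma bddAbove_topSum [Fintype α] (P : α → ℝ) (l : ℕ) :
    BddAbove {s : ℝ | ∃ A : Finset α, A.card ≤ l ∧ s = ∑ x ∈ A, P x} := by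
  refine Set.Finite.bddAbove ((Set.finite_range fun A : Finset α => ∑ x ∈ A, P x).subset ?_)
  rintro s ⟨A, _, rfl⟩
  exact ⟨A, rfl⟩

lemma sum_le_topSum [Fintype α] (P : α → ℝ) {l : ℕ} {A : Finset α} (hA : A.card ≤ l) :
    ∑ x ∈ A, P x ≤ topSum P l :=
  le_csSup (bddAbove_topSum P l) ⟨A, hA, rfl⟩

lemma topSum_le [Fintype α] (P : α → ℝ) {l : ℕ} {c : ℝ}
    (h : ∀ A : Finset α, A.card ≤ l → ∑ x ∈ A, P x ≤ c) : topSum P l ≤ c := by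
  refine csSup_le ⟨0, ∅, by simp⟩ ?_
  rintro s ⟨A, hA, rfl⟩
  exact h A hA

lemma maj_push [Fintype α] [Fintype β] {P : α → ℝ} (hP : ∀ x, 0 ≤ P x) (W : α → β) :
    Maj P (push W P) := by
  classical
  intro l
  refine topSum_le _ fun A hA => ?_
  exact (sum_le_sum_push_image hP W A).trans
    (sum_le_topSum _ (Finset.card_image_le.trans hA))

lemma fid_le_FD [Fintype α] [Fintype β] {P : α → ℝ} {Q : β → ℝ} (hP : IsProb P) (hQ : IsProb Q)
    (W : α → β) : fid (push W P) Q ≤ FD P Q := by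
  refine le_csSup ⟨1, ?_⟩ ⟨W, rfl⟩
  rintro r ⟨W, rfl⟩
  exact fid_le_one (isProb_push hP W) hQ

lemma FD_le_FM [Fintype α] [Fintype β] {P : α → ℝ} {Q : β → ℝ} (hP : IsProb P) (hQ : IsProb Q) :
    FD P Q ≤ FM P Q := by
  obtain ⟨y⟩ := hQ.nonempty
  refine csSup_le_csSup ⟨1, ?_⟩ ⟨_, fun _ => y, rfl⟩ ?_
  · rintro r ⟨R, hR, _, rfl⟩
    exact fid_le_one hR hQ
  · rintro r ⟨W, rfl⟩
    exact ⟨_, isProb_push hP W, maj_push hP.1 W, rfl⟩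

lemma FM_le [Fintype α] [Fintype β] {P : α → ℝ} {Q : β → ℝ} (hP : IsProb P) (hQ : IsProb Q)
    {c : ℝ} (h : ∀ R : β → ℝ, IsProb R → Maj P R → fid R Q ≤ c) : FM P Q ≤ c := by
  obtain ⟨y⟩ := hQ.nonempty
  refine csSup_le ⟨_, _, isProb_push hP fun _ => y, maj_push hP.1 _, rfl⟩ ?_
  rintro r ⟨R, hR, hM, rfl⟩
  exact h R hR hM

/-- A subset whose sum approximates `w` from below, up to the largest summand. -/
lemma exists_subset_sum_near (p : α → ℝ) {δ : ℝ} (hδ : 0 ≤ δ) {w : ℝ} (hw : 0 ≤ w)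
    (s : Finset α) (h : ∀ x ∈ s, p x ≤ δ) (hs : w ≤ ∑ x ∈ s, p x) :
    ∃ t ⊆ s, w - δ ≤ ∑ x ∈ t, p x ∧ ∑ x ∈ t, p x ≤ w := by
  classical
  induction s using Finset.induction_on with
  | empty =>
    refine ⟨∅, le_rfl, ?_, ?_⟩ <;> simp at hs ⊢ <;> linarith
  | insert a s ha ih =>
    by_cases hc : w ≤ ∑ x ∈ s, p x
    · obtain ⟨t, ht, h1⟩ := ih (fun x hx => h x (Finset.mem_insert_of_mem hx)) hc
      exact ⟨t, ht.trans (Finset.subset_insert a s), h1⟩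
    · rw [Finset.sum_insert ha] at hs
      have := h a (Finset.mem_insert_self a s)
      exact ⟨s, Finset.subset_insert a s, by linarith, by linarith⟩

/-- Greedy transport: if, for every `y ∈ T`, the atoms of size at most `δ y` carry enough mass for
all the demands of rank at most that of `y`, then all demands can be met up to `δ`. -/
lemma exists_transport [Fintype α] [Nonempty β] (p : α → ℝ) (hp : ∀ x, 0 ≤ p x) (w δ key : β → ℝ)
    (hδ : ∀ y, 0 ≤ δ y) (hw : ∀ y, 0 ≤ w y) (T : Finset β)
    (h : ∀ y ∈ T, ∑ y' ∈ T with key y' ≤ key y, w y' ≤ ∑ x with p x ≤ δ y, p x) :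
    ∃ W : α → β, ∀ y ∈ T, w y - δ y ≤ push W p y := by
  classical
  suffices H : ∃ (W : α → β) (D : Finset α), ∑ x ∈ D, p x ≤ ∑ y ∈ T, w y ∧
      ∀ y ∈ T, w y - δ y ≤ ∑ x ∈ D with W x = y, p x by
    obtain ⟨W, D, _, hW⟩ := H
    refine ⟨W, fun y hy => (hW y hy).trans ?_⟩
    unfold push
    rw [← Finset.sum_filter]
    convert Finset.sum_le_sum_of_subset_of_nonneg
      (Finset.filter_subset_filter _ (Finset.subset_univ D)) (fun x _ _ => hp x)
  induction T using Finset.induction_on_max_value key with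
  | empty => exact ⟨fun _ => Classical.arbitrary β, ∅, by simp, by simp⟩
  | insert a s ha hmax ih =>
    obtain ⟨W, D, hD, hW⟩ := ih fun y hy => by
      refine le_trans ?_ (h y (Finset.mem_insert_of_mem hy))
      exact Finset.sum_le_sum_of_subset_of_nonneg
        (Finset.filter_subset_filter _ (Finset.subset_insert a s)) (fun y _ _ => hw y)
    have h1 := h a (Finset.mem_insert_self a s)
    rw [Finset.filter_true_of_mem (by
      intro y hy
      rcases Finset.mem_insert.1 hy with rfl | hy
      exacts [le_rfl, hmax y hy]), Finset.sum_insert ha] at h1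
    have h2 : w a ≤ ∑ x ∈ (Finset.univ.filter fun x => p x ≤ δ a) \ D, p x := by
      have := Finset.sum_le_sum_of_subset_of_nonneg
        (s := Finset.univ.filter fun x => p x ≤ δ a)
        (t := (Finset.univ.filter fun x => p x ≤ δ a) \ D ∪ D) (f := p)
        (by intro x hx; by_cases x ∈ D <;> simp_all) (fun x _ _ => hp x)
      rw [Finset.sum_union Finset.sdiff_disjoint] at this
      linarith
    obtain ⟨t, hts, ht1, ht2⟩ := exists_subset_sum_near p (hδ a) (hw a) _
      (by intro x hx; simp at hx; exact hx.1) h2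
    have htD : Disjoint D t := by
      rw [Finset.disjoint_right]
      intro x hx
      exact (Finset.mem_sdiff.1 (hts hx)).2
    refine ⟨fun x => if x ∈ t then a else W x, D ∪ t, ?_, ?_⟩
    · rw [Finset.sum_union htD, Finset.sum_insert ha]
      linarith
    · intro y hy
      rcases Finset.mem_insert.1 hy with rfl | hy
      · refine ht1.trans (Finset.sum_le_sum_of_subset_of_nonneg ?_ (fun x _ _ => hp x))
        intro x hx
        simp [hx]
      · refine (hW y hy).trans (Finset.sum_le_sum_of_subset_of_nonneg ?_ (fun x _ _ => hp x))
        intro x hx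
        rw [Finset.mem_filter] at hx
        have : x ∉ t := Finset.disjoint_left.1 htD hx.1
        simp [hx.1, hx.2, this]

lemma exists_perm_monovary [Fintype β] (R Q : β → ℝ) : ∃ σ : Equiv.Perm β, Monovary (R ∘ σ) Q := by
  let e := Fintype.equivFin β
  let u := Tuple.sort (R ∘ e.symm)
  let v := Tuple.sort (Q ∘ e.symm)
  have hu : Monotone ((R ∘ e.symm) ∘ u) := Tuple.monotone_sort _
  have hv : Monotone ((Q ∘ e.symm) ∘ v) := Tuple.monotone_sort _
  refine ⟨((e.trans v.symm).trans u).trans e.symm, fun i j hij => ?_⟩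
  have h1 : v.symm (e i) ≤ v.symm (e j) := by
    by_contra hc
    have := hv (not_le.1 hc).le
    simp at this
    linarith
  simpa using hu h1

lemma sum_le_sum_of_card_le [Fintype β] {f : β → ℝ} (hf : ∀ y, 0 ≤ f y) {A S : Finset β}
    (hc : A.card ≤ S.card) (h : ∀ y ∈ S, ∀ z ∉ S, f z ≤ f y) : ∑ y ∈ A, f y ≤ ∑ y ∈ S, f y := by
  classical
  rcases S.eq_empty_or_nonempty with rfl | hS
  · simp at hc
    simp [hc]
  set m := S.inf' hS f
  have hm : 0 ≤ m := (Finset.le_inf'_iff hS f).2 fun y _ => hf y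
  have h1 : ∑ y ∈ A \ S, f y ≤ (A \ S).card * m := by
    rw [← nsmul_eq_mul]
    refine Finset.sum_le_card_nsmul _ _ _ fun z hz => ?_
    exact (Finset.le_inf'_iff hS f).2 fun y hy => h y hy z (Finset.mem_sdiff.1 hz).2
  have h2 : ((S \ A).card : ℝ) * m ≤ ∑ y ∈ S \ A, f y := by
    rw [← nsmul_eq_mul]
    exact Finset.card_nsmul_le_sum _ _ _ fun z hz => Finset.inf'_le f (Finset.mem_sdiff.1 hz).1
  have h3 : ((A \ S).card : ℝ) ≤ (S \ A).card := by
    exact_mod_cast Finset.card_sdiff_le_card_sdiff_iff.2 hc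
  have h4 := mul_le_mul_of_nonneg_right h3 hm
  have h5 := Finset.sum_inter_add_sum_sdiff A S f
  have h6 := Finset.sum_inter_add_sum_sdiff S A f
  rw [Finset.inter_comm] at h6
  linarith

lemma fid_le_fid_comp_perm [Fintype β] {R Q : β → ℝ} (hR : ∀ y, 0 ≤ R y)
    (σ : Equiv.Perm β) (hσ : Monovary (R ∘ σ) Q) : fid R Q ≤ fid (R ∘ σ) Q := by
  have h : Monovary (fun y => √(R (σ y))) (fun y => √(Q y)) := by
    intro i j hij
    refine Real.sqrt_le_sqrt (hσ ?_)
    by_contra hc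
    exact absurd (Real.sqrt_le_sqrt (not_lt.1 hc)) (not_le.2 hij)
  have := h.sum_comp_perm_mul_le_sum_mul (σ := σ⁻¹)
  unfold fid
  simpa [Real.sqrt_mul, hR] using this

lemma sum_range_sdiff [DecidableEq β] (S : ℕ → Finset β) (hS : Monotone S) (hS0 : S 0 = ∅)
    (f : β → ℝ) (K : ℕ) : ∑ i ∈ Finset.range K, ∑ y ∈ S (i + 1) \ S i, f y = ∑ y ∈ S K, f y := by
  induction K with
  | zero => simp [hS0]
  | succ K ih =>
    rw [Finset.sum_range_succ, ih, add_comm, Finset.sum_sdiff (hS K.le_succ)]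

/-- Coarse-graining bound: the fidelity with any distribution majorizing `P` is bounded by the
fidelity of the masses of the cells `S (i + 1) \ S i`, where the `S i` are level sets of `Q`. -/
lemma exists_coarse_bound [Fintype α] [Fintype β] {P : α → ℝ} {Q R : β → ℝ}
    (hQ : IsProb Q) (hR : IsProb R) (hM : Maj P R)
    (S : ℕ → Finset β) (hS : Monotone S) (hS0 : S 0 = ∅) {K : ℕ} (hSK : S K = Finset.univ)
    (hup : ∀ i, ∀ y ∈ S i, ∀ z ∉ S i, Q z < Q y) :
    ∃ F : ℕ → ℝ, Monotone F ∧ F 0 = 0 ∧ F K = 1 ∧ (∀ i, topSum P (S i).card ≤ F i) ∧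
      fid R Q ≤ ∑ i ∈ Finset.range K,
        √((F (i + 1) - F i) * (∑ y ∈ S (i + 1), Q y - ∑ y ∈ S i, Q y)) := by
  classical
  obtain ⟨σ, hσ⟩ := exists_perm_monovary R Q
  refine ⟨fun i => ∑ y ∈ S i, R (σ y), ?_, by simp [hS0], ?_, ?_, ?_⟩
  · intro i j hij
    exact Finset.sum_le_sum_of_subset_of_nonneg (hS hij) fun y _ _ => hR.1 _
  · simp only [hSK]
    rw [Equiv.sum_comp σ R, hR.2]
  · intro i
    refine (hM _).trans (topSum_le _ fun A hA => ?_)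
    have : ∑ y ∈ A, R y = ∑ y ∈ A.map σ⁻¹.toEmbedding, R (σ y) := by
      rw [Finset.sum_map]
      simp
    rw [this]
    refine sum_le_sum_of_card_le (f := fun y => R (σ y)) (fun y => hR.1 _) (by simpa using hA) ?_
    intro y hy z hz
    exact hσ (hup i y hy z hz)
  · refine (fid_le_fid_comp_perm hR.1 σ hσ).trans ?_
    unfold fid
    rw [← hSK, ← sum_range_sdiff S hS hS0]
    refine Finset.sum_le_sum fun i _ => ?_
    simp only
    rw [← Finset.sum_sdiff (f := fun y => R (σ y)) (hS (Nat.le_add_right i 1)),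
      ← Finset.sum_sdiff (f := Q) (hS (Nat.le_add_right i 1)), add_sub_cancel_right,
      add_sub_cancel_right, Real.sqrt_mul (Finset.sum_nonneg fun y _ => hR.1 _)]
    calc _ = ∑ y ∈ S (i + 1) \ S i, √(R (σ y)) * √(Q y) := by simp [Real.sqrt_mul, hR.1]
      _ ≤ _ := Real.sum_sqrt_mul_sqrt_le _ (fun y => hR.1 _) hQ.1

lemma sum_mul_le_of_neg_le {D g : ℕ → ℝ} {ε : ℝ} (m : ℕ) (hD0 : D 0 = 0) (hD : ∀ i, -ε ≤ D i)
    (hg : ∀ i < m, g i ≤ g (i + 1)) :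
    ∑ i ∈ Finset.range (m + 1), (D (i + 1) - D i) * g i ≤ D (m + 1) * g m + ε * (g m - g 0) := by
  induction m with
  | zero => simp [hD0]
  | succ m ih =>
    rw [Finset.sum_range_succ]
    have h1 := ih fun i hi => hg i (by omega)
    have h2 := hD (m + 1)
    have h3 := hg m (by omega)
    nlinarith

/-- Under an approximate dominance constraint on the cumulative sums, the fidelity with `b` is
almost maximized by `a` when `b / a` is increasing. -/
lemma sum_sqrt_le_of_dominated {F A B : ℕ → ℝ} {ε : ℝ} (hε : 0 ≤ ε) (m : ℕ)
    (hF : Monotone F) (h0 : F 0 = A 0) (hm : F (m + 1) = A (m + 1)) (hFA : ∀ i, A i - ε ≤ F i)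
    (ha : ∀ i ≤ m, 0 < A (i + 1) - A i) (hb : ∀ i ≤ m, 0 < B (i + 1) - B i)
    (hmono : ∀ i < m, (B (i + 1) - B i) / (A (i + 1) - A i) ≤
      (B (i + 2) - B (i + 1)) / (A (i + 2) - A (i + 1))) :
    ∑ i ∈ Finset.range (m + 1), √((F (i + 1) - F i) * (B (i + 1) - B i)) ≤
      ∑ i ∈ Finset.range (m + 1), √((A (i + 1) - A i) * (B (i + 1) - B i)) +
        ε * √((B (m + 1) - B m) / (A (m + 1) - A m)) := by
  set g : ℕ → ℝ := fun i => √((B (i + 1) - B i) / (A (i + 1) - A i)) with hg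
  have hterm : ∀ i ∈ Finset.range (m + 1), √((F (i + 1) - F i) * (B (i + 1) - B i)) ≤
      √((A (i + 1) - A i) * (B (i + 1) - B i)) +
        1 / 2 * (((F (i + 1) - A (i + 1)) - (F i - A i)) * g i) := by
    intro i hi
    have hi' : i ≤ m := Nat.lt_succ_iff.1 (Finset.mem_range.1 hi)
    have ha' := ha i hi'
    have hb' := hb i hi'
    have hf : 0 ≤ F (i + 1) - F i := sub_nonneg.2 (hF i.le_succ)
    set a := A (i + 1) - A i
    set b := B (i + 1) - B i
    set f := F (i + 1) - F i
    have hga : g i * a = √(a * b) := by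
      rw [hg]
      show √(b / a) * a = _
      rw [Real.sqrt_div hb'.le, Real.sqrt_mul ha'.le]
      field_simp
      rw [Real.sq_sqrt ha'.le]
    have hgpos : 0 < g i := Real.sqrt_pos.2 (div_pos hb' ha')
    have hgg : g i * g i * a = b := by
      rw [hg]
      show √(b / a) * √(b / a) * a = _
      rw [Real.mul_self_sqrt (div_pos hb' ha').le]
      field_simp
    have e : (F (i + 1) - A (i + 1)) - (F i - A i) = f - a := by ring
    rw [e, ← hga, Real.sqrt_le_left (by nlinarith [mul_nonneg hgpos.le hf, mul_pos hgpos ha'])]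
    have : f * b = g i * g i * (f * a) := by rw [← hgg]; ring
    rw [this]
    nlinarith [mul_nonneg (mul_self_nonneg (g i)) (sq_nonneg (f - a))]
  refine (Finset.sum_le_sum hterm).trans ?_
  rw [Finset.sum_add_distrib, ← Finset.mul_sum]
  have := sum_mul_le_of_neg_le (D := fun i => F i - A i) (g := g) (ε := ε) m (by simp [h0])
    (fun i => by linarith [hFA i]) (fun i hi => Real.sqrt_le_sqrt (hmono i hi))
  simp only [hm, sub_self, zero_mul, zero_add] at this
  have h1 : 0 ≤ g 0 := Real.sqrt_nonneg _
  have h2 : 0 ≤ g m := Real.sqrt_nonneg _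
  have h3 := mul_nonneg hε h1
  have h4 := mul_nonneg hε h2
  have : ε * g m = ε * √((B (m + 1) - B m) / (A (m + 1) - A m)) := rfl
  simp only [hm] at *
  nlinarith

lemma normalPDF_eq (m : ℝ) {v : ℝ} (hv : 0 < v) (x : ℝ) :
    normalPDF m v x = ProbabilityTheory.gaussianPDFReal m v.toNNReal x := by
  simp [normalPDF, ProbabilityTheory.gaussianPDFReal_def, hv.le]

lemma normalPDF_pos (m : ℝ) {v : ℝ} (hv : 0 < v) (x : ℝ) : 0 < normalPDF m v x := by
  unfold normalPDF
  positivity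

lemma integrable_normalPDF (m : ℝ) {v : ℝ} (hv : 0 < v) : Integrable (normalPDF m v) := by
  have : normalPDF m v = ProbabilityTheory.gaussianPDFReal m v.toNNReal :=
    funext fun x => normalPDF_eq m hv x
  rw [this]
  exact ProbabilityTheory.integrable_gaussianPDFReal _ _

lemma integral_normalPDF (m : ℝ) {v : ℝ} (hv : 0 < v) : ∫ x, normalPDF m v x = 1 := by
  simp_rw [normalPDF_eq m hv]
  exact ProbabilityTheory.integral_gaussianPDFReal_eq_one _ (by simpa using hv)

lemma gaussianReal_real_Iic (m : ℝ) {v : ℝ} (hv : 0 < v) (x : ℝ) :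
    (ProbabilityTheory.gaussianReal m v.toNNReal).real (Set.Iic x) =
      ∫ t in Set.Iic x, normalPDF m v t := by
  rw [measureReal_def, ProbabilityTheory.gaussianReal_apply_eq_integral _ (by simpa using hv),
    ENNReal.toReal_ofReal]
  · simp_rw [normalPDF_eq m hv]
  · exact integral_nonneg fun t => ProbabilityTheory.gaussianPDFReal_nonneg _ _ _

lemma setIntegral_Iic_normalPDF (m : ℝ) {v : ℝ} (hv : 0 < v) (x : ℝ) :
    ∫ t in Set.Iic x, normalPDF m v t = stdG ((x - m) / √v) := by
  have h : ProbabilityTheory.gaussianReal m v.toNNReal =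
      ((ProbabilityTheory.gaussianReal 0 (1 : ℝ).toNNReal).map (√v * ·)).map (· + m) := by
    rw [ProbabilityTheory.gaussianReal_map_const_mul, ProbabilityTheory.gaussianReal_map_add_const]
    congr 1
    · simp
    · ext
      simp [Real.sq_sqrt hv.le, hv.le]
  have hs : 0 < √v := Real.sqrt_pos.2 hv
  rw [← gaussianReal_real_Iic m hv, h, stdG, ← gaussianReal_real_Iic 0 one_pos,
    map_measureReal_apply (by fun_prop) measurableSet_Iic,
    map_measureReal_apply (by fun_prop) (by measurability)]
  congr 1
  ext t
  simp only [Set.mem_preimage, Set.mem_Iic]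
  rw [le_div_iff₀ hs, le_sub_iff_add_le, mul_comm]

lemma continuous_setIntegral_Iic {f : ℝ → ℝ} (hf : Integrable f) :
    Continuous fun x => ∫ t in Set.Iic x, f t := by
  have : (fun x => ∫ t in Set.Iic x, f t) =
      fun x => (∫ t in Set.Iic (0 : ℝ), f t) + ∫ t in (0 : ℝ)..x, f t := by
    ext x
    rw [← intervalIntegral.integral_Iic_sub_Iic hf.integrableOn hf.integrableOn]
    ring
  rw [this]
  exact continuous_const.add (hf.continuous_primitive 0)

lemma continuous_stdG : Continuous stdG := by
  unfold stdG
  exact continuous_setIntegral_Iic (integrable_normalPDF 0 one_pos)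

/-- The total mass of the atoms of size at least `θ`. -/
noncomputable def levelMass [Fintype α] (p : α → ℝ) (θ : ℝ) : ℝ := ∑ x with θ ≤ p x, p x

lemma levelMass_antitone [Fintype α] {p : α → ℝ} (hp : ∀ x, 0 ≤ p x) : Antitone (levelMass p) := by
  intro s t hst
  exact Finset.sum_le_sum_of_subset_of_nonneg
    (Finset.monotone_filter_right _ fun x _ hx => hst.trans hx) fun x _ _ => hp x

section CentralLimit

variable [Fintype α]

/-- The measure with point masses `P x`. -/
noncomputable def pointMeasure [MeasurableSpace α] (P : α → ℝ) : Measure α :=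
  ∑ x, ENNReal.ofReal (P x) • Measure.dirac x

lemma pointMeasure_singleton [MeasurableSpace α] [MeasurableSingletonClass α] (P : α → ℝ) (x : α) :
    pointMeasure P {x} = ENNReal.ofReal (P x) := by
  classical
  simp [pointMeasure, Set.indicator_apply]

lemma isProbabilityMeasure_pointMeasure [MeasurableSpace α] {P : α → ℝ} (hP : IsProb P) :
    IsProbabilityMeasure (pointMeasure P) := by
  constructor
  simp only [pointMeasure, Measure.coe_finsetSum, Measure.coe_smul, Finset.sum_apply, Pi.smul_apply,
    measure_univ, smul_eq_mul, mul_one]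
  rw [← ENNReal.ofReal_sum_of_nonneg fun x _ => hP.1 x, hP.2, ENNReal.ofReal_one]

lemma integral_pointMeasure [MeasurableSpace α] [MeasurableSingletonClass α] {P : α → ℝ}
    (hP : IsProb P) (f : α → ℝ) : ∫ x, f x ∂(pointMeasure P) = ∑ x, P x * f x := by
  have := isProbabilityMeasure_pointMeasure hP
  rw [integral_fintype (Integrable.of_finite)]
  simp [measureReal_def, pointMeasure_singleton, hP.1]

lemma infinitePi_real_prefix [MeasurableSpace α] [MeasurableSingletonClass α] {P : α → ℝ}
    (hP : IsProb P) (n : ℕ) (A : Set (Fin n → α)) [DecidablePred (· ∈ A)] :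
    (Measure.infinitePi fun _ : ℕ => pointMeasure P).real {ω | (fun i : Fin n => ω i) ∈ A} =
      ∑ f with f ∈ A, iid P n f := by
  classical
  have := isProbabilityMeasure_pointMeasure hP
  have h := ProbabilityTheory.iIndepFun_infinitePi (P := fun _ : ℕ => pointMeasure P)
    (X := fun _ => id) (fun _ => measurable_id)
  have h' := h.precomp (g := fun i : Fin n => (i : ℕ)) Fin.val_injective
  replace h' := (ProbabilityTheory.iIndepFun_iff_map_fun_eq_pi_map
    (by exact fun i => (measurable_pi_apply (i : ℕ)).aemeasurable)).1 h'
  simp only [id] at h'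
  have hm : ∀ i : ℕ, (Measure.infinitePi fun _ : ℕ => pointMeasure P).map (fun ω => ω i) =
      pointMeasure P := fun i => Measure.infinitePi_map_eval _ i
  have e : {ω : ℕ → α | (fun i : Fin n => ω i) ∈ A} = (fun ω (i : Fin n) => ω i) ⁻¹' A := rfl
  rw [e, ← map_measureReal_apply (by fun_prop) A.toFinite.measurableSet, h']
  simp only [hm]
  have e2 : A = ((Finset.univ.filter fun f => f ∈ A : Finset (Fin n → α)) : Set (Fin n → α)) := by
    ext; simp
  conv_lhs => rw [e2]
  rw [← sum_measureReal_singleton]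
  refine Finset.sum_congr rfl fun f _ => ?_
  simp only [measureReal_def, Measure.pi_singleton, pointMeasure_singleton, ENNReal.toReal_prod,
    iid, ENNReal.toReal_ofReal (hP.1 _)]

lemma levelMass_iid_eq {P : α → ℝ} (hP : IsProb P) (n : ℕ) (c : ℝ)
    [DecidablePred (· ∈ {f : Fin n → α | ∑ i, -Real.log (P (f i)) ≤ c})] :
    levelMass (iid P n) (Real.exp (-c)) =
      ∑ f with f ∈ {f : Fin n → α | ∑ i, -Real.log (P (f i)) ≤ c}, iid P n f := by
  unfold levelMass
  rw [Finset.sum_filter, Finset.sum_filter]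
  refine Finset.sum_congr rfl fun f _ => ?_
  by_cases h0 : iid P n f = 0
  · simp [h0]
  · have hpos : 0 < iid P n f := lt_of_le_of_ne ((isProb_iid hP n).1 f) (Ne.symm h0)
    have hne : ∀ i ∈ Finset.univ, P (f i) ≠ 0 := Finset.prod_ne_zero_iff.1 h0
    have : Real.exp (-c) ≤ iid P n f ↔ ∑ i, -Real.log (P (f i)) ≤ c := by
      rw [← Real.le_log_iff_exp_le hpos, iid, Real.log_prod hne, Finset.sum_neg_distrib]
      constructor <;> intro h <;> linarith
    simp [this]

/-- Central limit theorem for the self-information of an i.i.d. product. -/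
lemma tendsto_levelMass_iid {P : α → ℝ} (hP : IsProb P) (hV : 0 < V P) (z : ℝ) :
    Tendsto (fun n : ℕ => levelMass (iid P n) (Real.exp (-(n * H P + √n * z)))) atTop
      (nhds (stdG (z / √(V P)))) := by
  classical
  let _ : MeasurableSpace α := ⊤
  have := isProbabilityMeasure_pointMeasure hP
  set μ := Measure.infinitePi fun _ : ℕ => pointMeasure P with hμ
  set Z : ℕ → (ℕ → α) → ℝ := fun i ω => -Real.log (P (ω i)) with hZ
  have hmeas : ∀ i, Measurable (Z i) := fun i => by
    have : Measurable fun x => -Real.log (P x) := measurable_from_top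
    exact this.comp (measurable_pi_apply i)
  have hev : ∀ i : ℕ, μ.map (fun ω => ω i) = pointMeasure P := fun i =>
    Measure.infinitePi_map_eval _ i
  have hint : ∀ f : α → ℝ, ∫ ω, f (ω 0) ∂μ = ∑ x, P x * f x := fun f => by
    rw [← integral_pointMeasure hP f, ← hev 0, integral_map (measurable_pi_apply 0).aemeasurable]
    exact measurable_from_top.aestronglyMeasurable
  have hmean : ∫ ω, Z 0 ω ∂μ = H P := by
    simp only [hZ]
    rw [hint fun x => -Real.log (P x)]
    simp [H]
  have hvar : ProbabilityTheory.variance (Z 0) μ = V P := by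
    rw [ProbabilityTheory.variance_eq_integral (hmeas 0).aemeasurable, hmean]
    simp only [hZ]
    rw [hint fun x => (-Real.log (P x) - H P) ^ 2]
    rfl
  have hindep : ProbabilityTheory.iIndepFun Z μ :=
    ProbabilityTheory.iIndepFun_infinitePi (P := fun _ : ℕ => pointMeasure P)
      (X := fun _ x => -Real.log (P x)) (fun _ => measurable_from_top)
  have hident : ∀ i, ProbabilityTheory.IdentDistrib (Z i) (Z 0) μ μ := fun i => by
    have : ProbabilityTheory.IdentDistrib (fun ω : ℕ → α => ω i) (fun ω => ω 0) μ μ :=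
      ⟨(measurable_pi_apply i).aemeasurable, (measurable_pi_apply 0).aemeasurable, by rw [hev, hev]⟩
    exact this.comp (u := fun x => -Real.log (P x)) measurable_from_top
  have hLp : MemLp (Z 0) 2 μ := by
    refine MemLp.of_bound (hmeas 0).aestronglyMeasurable (∑ x, ‖-Real.log (P x)‖)
      (Eventually.of_forall fun ω => ?_)
    exact Finset.single_le_sum (f := fun x => ‖-Real.log (P x)‖) (fun _ _ => norm_nonneg _)
      (Finset.mem_univ (ω 0))
  have hclt := (ProbabilityTheory.tendstoInDistribution_inv_sqrt_mul_sum_sub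
    (Y := (id : ℝ → ℝ)) (P' := ProbabilityTheory.gaussianReal 0 (V P).toNNReal)
    (by rw [hvar]; exact ⟨by fun_prop, by simp⟩) hLp hindep hident).tendsto
  have hfr : (ProbabilityTheory.gaussianReal 0 (V P).toNNReal) (frontier (Set.Iic z)) = 0 := by
    have := ProbabilityTheory.nullSingletonClass_gaussianReal (μ := 0) (v := (V P).toNNReal)
      (by simpa using hV)
    rw [frontier_Iic]
    exact measure_singleton _
  have key := ProbabilityMeasure.tendsto_measure_of_null_frontier_of_tendsto' hclt
    (E := Set.Iic z) (by simpa using hfr)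
  simp only [ProbabilityMeasure.coe_mk, Measure.map_id] at key
  have key2 := (ENNReal.tendsto_toReal (measure_ne_top _ _)).comp key
  have hlim : stdG (z / √(V P)) =
      (ProbabilityTheory.gaussianReal 0 (V P).toNNReal).real (Set.Iic z) := by
    rw [gaussianReal_real_Iic 0 hV, setIntegral_Iic_normalPDF 0 hV, sub_zero]
  rw [hlim]
  refine Tendsto.congr' ?_ (by simpa [measureReal_def] using key2)
  filter_upwards [eventually_gt_atTop 0] with n hn
  have hn' : 0 < √(n : ℝ) := by positivity
  rw [levelMass_iid_eq hP, ← infinitePi_real_prefix hP n]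
  simp only [Function.comp]
  rw [Measure.map_apply (by fun_prop) measurableSet_Iic, measureReal_def]
  congr 2
  ext ω
  simp only [Set.mem_preimage, Set.mem_Iic, Set.mem_ofPred_eq]
  rw [inv_mul_le_iff₀ hn', hmean, Fin.sum_univ_eq_sum_range (fun i => -Real.log (P (ω i))) n]
  constructor <;> intro h <;> linarith

/-- Version of the central limit theorem along a subsequence and with a converging threshold. -/
lemma tendsto_levelMass_iid_of_tendsto {P : α → ℝ} (hP : IsProb P) (hV : 0 < V P) {L : ℕ → ℕ}
    (hL : Tendsto L atTop atTop) {z : ℕ → ℝ} {z₀ : ℝ} (hz : Tendsto z atTop (nhds z₀)) :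
    Tendsto (fun n : ℕ => levelMass (iid P (L n)) (Real.exp (-(L n * H P + √(L n) * z n)))) atTop
      (nhds (stdG (z₀ / √(V P)))) := by
  have hc : ContinuousAt (fun t => stdG (t / √(V P))) z₀ :=
    (continuous_stdG.comp (continuous_id.div_const _)).continuousAt
  have hlim := fun t => (tendsto_levelMass_iid hP hV t).comp hL
  have hmono : ∀ n {s t : ℝ}, s ≤ t →
      levelMass (iid P (L n)) (Real.exp (-(L n * H P + √(L n) * s))) ≤
        levelMass (iid P (L n)) (Real.exp (-(L n * H P + √(L n) * t))) := fun n s t hst => by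
    refine levelMass_antitone (isProb_iid hP _).1 (Real.exp_le_exp.2 ?_)
    have := mul_le_mul_of_nonneg_left hst (Real.sqrt_nonneg (L n : ℝ))
    linarith
  refine tendsto_order.2 ⟨fun a ha => ?_, fun a ha => ?_⟩
  · obtain ⟨t, ht, hta⟩ := ((hc.eventually (lt_mem_nhds ha)).filter_mono nhdsWithin_le_nhds
      |>.and (self_mem_nhdsWithin : Set.Iio z₀ ∈ nhdsWithin z₀ (Set.Iio z₀))).exists
    filter_upwards [(hlim t).eventually (lt_mem_nhds ht), hz.eventually (lt_mem_nhds hta)]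
      with n h1 h2
    exact h1.trans_le (hmono n h2.le)
  · obtain ⟨t, ht, hta⟩ := ((hc.eventually (gt_mem_nhds ha)).filter_mono nhdsWithin_le_nhds
      |>.and (self_mem_nhdsWithin : Set.Ioi z₀ ∈ nhdsWithin z₀ (Set.Ioi z₀))).exists
    filter_upwards [(hlim t).eventually (gt_mem_nhds ht), hz.eventually (gt_mem_nhds hta)]
      with n h1 h2
    exact (hmono n h2.le).trans_lt h1

lemma H_nonneg {P : α → ℝ} (hP : IsProb P) : 0 ≤ H P := by
  refine Finset.sum_nonneg fun x _ => neg_nonneg.2 ?_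
  refine mul_nonpos_of_nonneg_of_nonpos (hP.1 x) (Real.log_nonpos (hP.1 x) ?_)
  rw [← hP.2]
  exact Finset.single_le_sum (fun y _ => hP.1 y) (Finset.mem_univ x)

lemma H_pos {P : α → ℝ} (hP : IsProb P) (hV : 0 < V P) : 0 < H P := by
  refine lt_of_le_of_ne (H_nonneg hP) fun h0 => hV.ne' ?_
  have hle : ∀ x ∈ Finset.univ, 0 ≤ -(P x * Real.log (P x)) := fun x _ => by
    refine neg_nonneg.2 ?_
    refine mul_nonpos_of_nonneg_of_nonpos (hP.1 x) (Real.log_nonpos (hP.1 x) ?_)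
    rw [← hP.2]
    exact Finset.single_le_sum (fun y _ => hP.1 y) (Finset.mem_univ x)
  have hz := (Finset.sum_eq_zero_iff_of_nonneg hle).1 h0.symm
  refine Finset.sum_eq_zero fun x hx => ?_
  have := hz x hx
  rw [neg_eq_zero, mul_eq_zero] at this
  rcases this with h | h <;> simp [h, ← h0]

end CentralLimit

lemma tendsto_floor_div {a : ℝ} (ha : 0 < a) (b : ℝ) :
    Tendsto (fun n : ℕ => (⌊a * n + b * √n⌋₊ : ℝ) / n) atTop (nhds a) ∧
    Tendsto (fun n : ℕ => ⌊a * n + b * √n⌋₊) atTop atTop ∧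
    Tendsto (fun n : ℕ => ((⌊a * n + b * √n⌋₊ : ℝ) - (a * n + b * √n)) / √n) atTop (nhds 0) := by
  have hs : Tendsto (fun n : ℕ => √(n : ℝ)) atTop atTop :=
    Real.tendsto_sqrt_atTop.comp tendsto_natCast_atTop_atTop
  have hinv : Tendsto (fun n : ℕ => (√(n : ℝ))⁻¹) atTop (nhds 0) := tendsto_inv_atTop_zero.comp hs
  have h1 : Tendsto (fun n : ℕ => √(n : ℝ) * (a * √(n : ℝ) + b)) atTop atTop :=
    hs.atTop_mul_atTop₀ (tendsto_atTop_add_const_right _ _ (hs.const_mul_atTop ha))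
  have h2 : Tendsto (fun n : ℕ => a * n + b * √n) atTop atTop := by
    refine h1.congr fun n => ?_
    have := Real.mul_self_sqrt (Nat.cast_nonneg (α := ℝ) n)
    linear_combination a * this
  have h3 : Tendsto (fun n : ℕ => ((⌊a * n + b * √n⌋₊ : ℝ) - (a * n + b * √n)) / √n)
      atTop (nhds 0) := by
    refine squeeze_zero_norm' ?_ hinv
    filter_upwards [h2.eventually_ge_atTop 0] with n hn
    rw [norm_div, Real.norm_eq_abs, Real.norm_eq_abs, abs_of_nonneg (Real.sqrt_nonneg _),
      div_eq_mul_inv]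
    refine mul_le_of_le_one_left (by positivity) ?_
    rw [abs_le]
    constructor
    · linarith [Nat.lt_floor_add_one (a * n + b * √n)]
    · linarith [Nat.floor_le hn]
  refine ⟨?_, tendsto_nat_floor_atTop.comp h2, h3⟩
  have h4 : Tendsto (fun n : ℕ => a + b * (√(n : ℝ))⁻¹ +
      ((⌊a * n + b * √n⌋₊ : ℝ) - (a * n + b * √n)) / √n * (√(n : ℝ))⁻¹) atTop (nhds a) := by
    simpa using (tendsto_const_nhds.add (hinv.const_mul b)).add (h3.mul hinv)
  refine h4.congr' ?_
  filter_upwards [eventually_gt_atTop 0] with n hn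
  have hn' : 0 < √(n : ℝ) := by positivity
  have hsq : (n : ℝ) = √n * √n := (Real.mul_self_sqrt (Nat.cast_nonneg n)).symm
  generalize (⌊a * n + b * √n⌋₊ : ℝ) = l
  generalize √(n : ℝ) = r at *
  rw [hsq]
  field_simp
  ring

lemma tendsto_levelMass_target [Fintype α] [Fintype β] {P : α → ℝ} {Q : β → ℝ} (hP : IsProb P)
    (hQ : IsProb Q) (hVP : 0 < V P) (hVQ : 0 < V Q) (b x : ℝ) :
    Tendsto (fun n : ℕ => levelMass (iid Q ⌊H P / H Q * n + b * √n⌋₊)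
      (Real.exp (-(n * H P + √n * x)))) atTop (nhds (GPQ P Q b x)) := by
  have hHP := H_pos hP hVP
  have hHQ := H_pos hQ hVQ
  have ha : 0 < H P / H Q := div_pos hHP hHQ
  set a := H P / H Q with had
  obtain ⟨h1, h2, h3⟩ := tendsto_floor_div ha b
  set L : ℕ → ℕ := fun n => ⌊a * n + b * √n⌋₊ with hL
  have hz : Tendsto (fun n : ℕ => (√((L n : ℝ) / n))⁻¹ * ((x - b * H Q) -
      H Q * (((L n : ℝ) - (a * n + b * √n)) / √n))) atTop (nhds ((√a)⁻¹ * (x - b * H Q))) := by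
    have e1 := (h1.sqrt.inv₀ (Real.sqrt_pos.2 ha).ne')
    simpa using e1.mul ((h3.const_mul (H Q)).const_sub (x - b * H Q))
  have key := tendsto_levelMass_iid_of_tendsto hQ hVQ h2 hz
  have e : GPQ P Q b x = stdG ((√a)⁻¹ * (x - b * H Q) / √(V Q)) := by
    unfold GPQ
    congr 1
    have : √(H Q / (H P * V Q)) = (√a)⁻¹ / √(V Q) := by
      rw [← Real.sqrt_inv, ← Real.sqrt_div (by positivity), had]
      congr 1
      field_simp
    rw [this]
    ring
  rw [e]
  refine key.congr' ?_
  filter_upwards [eventually_gt_atTop 0, h2.eventually_gt_atTop 0] with n hn hLn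
  have hn' : 0 < √(n : ℝ) := by positivity
  have hLn' : 0 < √(L n : ℝ) := by
    have : (0 : ℝ) < L n := by exact_mod_cast hLn
    positivity
  congr 3
  have hd : √((L n : ℝ) / n) = √(L n) / √n := Real.sqrt_div (by positivity) _
  have hsq : (n : ℝ) = √n * √n := (Real.mul_self_sqrt (Nat.cast_nonneg n)).symm
  have hHPa : H P = a * H Q := by rw [had]; field_simp
  rw [hd]
  field_simp
  rw [hHPa]
  ring

lemma sum_level_sdiff [Fintype β] (q : β → ℝ) {s t : ℝ} (hst : s ≤ t) :
    ∑ y with s ≤ q y ∧ q y < t, q y = levelMass q s - levelMass q t := by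
  classical
  unfold levelMass
  rw [eq_sub_iff_add_eq, ← Finset.sum_union]
  · congr 1
    ext y
    simp only [Finset.mem_union, Finset.mem_filter, Finset.mem_univ, true_and]
    constructor
    · rintro (h | h)
      exacts [h.1, hst.trans h]
    · intro h
      rcases lt_or_ge (q y) t with h' | h'
      exacts [Or.inl ⟨h, h'⟩, Or.inr h']
  · rw [Finset.disjoint_left]
    intro y hy hy'
    simp only [Finset.mem_filter, Finset.mem_univ, true_and] at hy hy'
    linarith

lemma one_sub_levelMass_le [Fintype α] {p : α → ℝ} (hp : IsProb p) {s t : ℝ} (hst : s ≤ t) :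
    1 - levelMass p s ≤ ∑ x with p x ≤ t, p x := by
  classical
  have h : 1 - levelMass p s = ∑ x with p x < s, p x := by
    have := Finset.sum_filter_add_sum_filter_not Finset.univ (fun x => s ≤ p x) p
    simp only [hp.2, not_le] at this
    unfold levelMass
    linarith
  rw [h]
  exact Finset.sum_le_sum_of_subset_of_nonneg
    (Finset.monotone_filter_right _ fun x _ hx => hx.le.trans hst) fun x _ _ => hp.1 x

/-- One-shot lower bound on the fidelity reachable by a deterministic map, when each cell
`θ (i + 1) ≤ q < θ i` of the target receives the density `l i` with respect to `q`. -/
lemma sum_sqrt_mul_le_FD [Fintype α] [Fintype β] {p : α → ℝ} {q : β → ℝ} (hp : IsProb p)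
    (hq : IsProb q) {θ : ℕ → ℝ} (hθ : Antitone θ) {e : ℝ} (he : 0 ≤ e) (m : ℕ) {l : ℕ → ℝ}
    (hl : ∀ i, 0 ≤ l i)
    (hcond : ∀ i < m, ∑ j ∈ Finset.Ico i m, l j * (levelMass q (θ (j + 1)) - levelMass q (θ j)) ≤
      1 - levelMass p (e * θ (i + 1))) :
    ∑ i ∈ Finset.range m, √(l i - e) * (levelMass q (θ (i + 1)) - levelMass q (θ i)) ≤
      FD p q := by
  classical
  have := hq.nonempty
  let C : ℕ → Finset β := fun i => Finset.univ.filter fun y => θ (i + 1) ≤ q y ∧ q y < θ i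
  have hmem : ∀ i y, y ∈ C i ↔ θ (i + 1) ≤ q y ∧ q y < θ i := fun i y => by simp [C]
  have hCsum : ∀ i, ∑ y ∈ C i, q y = levelMass q (θ (i + 1)) - levelMass q (θ i) := fun i =>
    sum_level_sdiff q (hθ i.le_succ)
  have hlt : ∀ i j y, y ∈ C i → q y < θ j → j ≤ i := fun i j y hy hj => by
    by_contra hc
    have := hθ (Nat.succ_le_of_lt (not_le.1 hc))
    have := ((hmem i y).1 hy).1
    simp only [Nat.succ_eq_add_one] at *
    linarith
  have huniq : ∀ i j y, y ∈ C i → y ∈ C j → i = j := fun i j y hi hj =>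
    le_antisymm (hlt j i y hj ((hmem i y).1 hi).2) (hlt i j y hi ((hmem j y).1 hj).2)
  have hdisj : (Finset.range m : Set ℕ).PairwiseDisjoint C := fun i _ j _ hij =>
    Finset.disjoint_left.2 fun y hi hj => hij (huniq i j y hi hj)
  let lam : β → ℝ := fun y => ∑ i ∈ Finset.range m, if y ∈ C i then l i else 0
  have hlam : ∀ i < m, ∀ y ∈ C i, lam y = l i := fun i hi y hy => by
    show ∑ j ∈ Finset.range m, (if y ∈ C j then l j else 0) = l i
    rw [Finset.sum_eq_single i, if_pos hy]
    · intro j _ hj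
      rw [if_neg fun h => hj (huniq j i y h hy)]
    · simp [hi]
  have hlam0 : ∀ y, 0 ≤ lam y := fun y => Finset.sum_nonneg fun i _ => by
    split_ifs
    exacts [hl i, le_rfl]
  let T : Finset β := (Finset.range m).biUnion C
  obtain ⟨W, hW⟩ := exists_transport p hp.1 (fun y => lam y * q y) (fun y => e * q y) q
    (fun y => mul_nonneg he (hq.1 y)) (fun y => mul_nonneg (hlam0 y) (hq.1 y)) T (by
      intro y hy
      obtain ⟨i, hi, hyi⟩ := Finset.mem_biUnion.1 hy
      have hi' := Finset.mem_range.1 hi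
      have hyi' := (hmem i y).1 hyi
      refine le_trans ?_ ((hcond i hi').trans
        (one_sub_levelMass_le hp (mul_le_mul_of_nonneg_left hyi'.1 he)))
      rw [Finset.sum_filter, Finset.sum_biUnion hdisj, Finset.range_eq_Ico,
        ← Finset.sum_Ico_consecutive _ (Nat.zero_le i) hi'.le]
      have hz : ∑ j ∈ Finset.Ico 0 i, ∑ y' ∈ C j, (if q y' ≤ q y then lam y' * q y' else 0) = 0 := by
        refine Finset.sum_eq_zero fun j hj => Finset.sum_eq_zero fun y' hy' => ?_
        rw [if_neg]
        intro hle
        have := hlt j i y' hy' (hle.trans_lt hyi'.2)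
        have := (Finset.mem_Ico.1 hj).2
        omega
      rw [hz, zero_add]
      refine Finset.sum_le_sum fun j hj => ?_
      rw [← hCsum, Finset.mul_sum]
      refine Finset.sum_le_sum fun y' hy' => ?_
      rw [hlam j (Finset.mem_Ico.1 hj).2 y' hy']
      split_ifs
      exacts [le_rfl, mul_nonneg (hl j) (hq.1 y')])
  refine le_trans ?_ (fid_le_FD hp hq W)
  unfold fid
  calc _ = ∑ y ∈ T, √(lam y - e) * q y := by
        rw [Finset.sum_biUnion hdisj]
        refine Finset.sum_congr rfl fun i hi => ?_
        rw [← hCsum, Finset.mul_sum]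
        refine Finset.sum_congr rfl fun y hy => ?_
        rw [hlam i (Finset.mem_range.1 hi) y hy]
    _ ≤ ∑ y ∈ T, √(push W p y * q y) := by
        refine Finset.sum_le_sum fun y hy => ?_
        have : √(lam y - e) * q y = √((lam y - e) * (q y * q y)) := by
          rw [Real.sqrt_mul' _ (mul_self_nonneg _), Real.sqrt_mul_self (hq.1 y)]
        rw [this, ← mul_assoc]
        refine Real.sqrt_le_sqrt (mul_le_mul_of_nonneg_right ?_ (hq.1 y))
        have := hW y hy
        linarith
    _ ≤ _ := Finset.sum_le_sum_of_subset_of_nonneg (Finset.subset_univ T)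
        fun y _ _ => Real.sqrt_nonneg _

/-- The atom size at level `z`, for the centering `h` and the scale `s`. -/
noncomputable def levelSize (h s z : ℝ) : ℝ := Real.exp (-(h + s * z))

lemma levelSize_pos (h s z : ℝ) : 0 < levelSize h s z := Real.exp_pos _

lemma levelSize_add (h s z t : ℝ) :
    levelSize h s (z + t) = Real.exp (-(s * t)) * levelSize h s z := by
  unfold levelSize
  rw [← Real.exp_add]
  congr 1
  ring

lemma levelSize_antitone {h s : ℝ} (hs : 0 ≤ s) : Antitone (levelSize h s) := fun x y hxy => by
  have := mul_le_mul_of_nonneg_left hxy hs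
  exact Real.exp_le_exp.2 (by linarith)

section Asymptotic

variable {X Y : ℕ → Type*} [∀ n, Fintype (X n)] [∀ n, Fintype (Y n)]
  {p : ∀ n, X n → ℝ} {q : ∀ n, Y n → ℝ} {h s : ℕ → ℝ} {A B : ℝ → ℝ}

lemma tendsto_exp_neg_mul {s : ℕ → ℝ} (hs : Tendsto s atTop atTop) {ε : ℝ} (hε : 0 < ε) :
    Tendsto (fun n => Real.exp (-(s n * ε))) atTop (nhds 0) :=
  Real.tendsto_exp_neg_atTop_nhds_zero.comp (hs.atTop_mul_const hε)

lemma eventually_lt_FD (hp : ∀ n, IsProb (p n)) (hq : ∀ n, IsProb (q n))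
    (hs : Tendsto s atTop atTop)
    (hA : ∀ z, Tendsto (fun n => levelMass (p n) (levelSize (h n) (s n) z)) atTop (nhds (A z)))
    (hB : ∀ z, Tendsto (fun n => levelMass (q n) (levelSize (h n) (s n) z)) atTop (nhds (B z)))
    {x : ℕ → ℝ} (hx : Monotone x) (m : ℕ) {l : ℕ → ℝ} (hl : ∀ i, 0 ≤ l i) {ε : ℝ} (hε : 0 < ε)
    (hcond : ∀ i < m, ∑ j ∈ Finset.Ico i m, l j * (B (x (j + 1)) - B (x j)) <
      1 - A (x (i + 1) + ε))
    {c : ℝ} (hc : c < ∑ i ∈ Finset.range m, √(l i) * (B (x (i + 1)) - B (x i))) :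
    ∀ᶠ n in atTop, c < FD (p n) (q n) := by
  have hexp := tendsto_exp_neg_mul hs hε
  have h1 : ∀ᶠ n in atTop, ∀ i ∈ Finset.range m, ∑ j ∈ Finset.Ico i m,
      l j * (levelMass (q n) (levelSize (h n) (s n) (x (j + 1))) -
        levelMass (q n) (levelSize (h n) (s n) (x j))) <
      1 - levelMass (p n) (levelSize (h n) (s n) (x (i + 1) + ε)) := by
    rw [Filter.eventually_all_finset]
    intro i hi
    refine Tendsto.eventually_lt ?_ ((hA _).const_sub 1) (hcond i (Finset.mem_range.1 hi))
    exact tendsto_finsetSum _ fun j _ => ((hB _).sub (hB _)).const_mul _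
  have h2 : Tendsto (fun n => ∑ i ∈ Finset.range m, √(l i - Real.exp (-(s n * ε))) *
      (levelMass (q n) (levelSize (h n) (s n) (x (i + 1))) -
        levelMass (q n) (levelSize (h n) (s n) (x i)))) atTop
      (nhds (∑ i ∈ Finset.range m, √(l i) * (B (x (i + 1)) - B (x i)))) := by
    refine tendsto_finsetSum _ fun i _ => Tendsto.mul ?_ ((hB _).sub (hB _))
    simpa using (hexp.const_sub (l i)).sqrt
  filter_upwards [h1, h2.eventually (lt_mem_nhds hc), hs.eventually_ge_atTop 0] with n h1 h2 hs0
  refine h2.trans_le (sum_sqrt_mul_le_FD (hp n) (hq n)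
    (θ := fun i => levelSize (h n) (s n) (x i))
    (fun i j hij => levelSize_antitone hs0 (hx hij)) (Real.exp_pos _).le m hl ?_)
  intro i hi
  rw [← levelSize_add]
  exact (h1 i (Finset.mem_range.2 hi)).le

lemma eventually_lt_topSum (hp : ∀ n, IsProb (p n)) (hs : Tendsto s atTop atTop)
    (hA : ∀ z, Tendsto (fun n => levelMass (p n) (levelSize (h n) (s n) z)) atTop (nhds (A z)))
    (hB : ∀ z, Tendsto (fun n => levelMass (q n) (levelSize (h n) (s n) z)) atTop (nhds (B z)))
    (hAc : Continuous A) (hBm : StrictMono B) (x : ℝ) {c : ℝ} (hc : c < A x) :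
    ∀ᶠ n in atTop, c <
      topSum (p n) (Finset.univ.filter fun y => levelSize (h n) (s n) x ≤ q n y).card := by
  obtain ⟨z, hzc, hzx⟩ := ((hAc.continuousAt.eventually (lt_mem_nhds hc)).filter_mono
    nhdsWithin_le_nhds |>.and (self_mem_nhdsWithin : Set.Iio x ∈ nhdsWithin x (Set.Iio x))).exists
  obtain ⟨u, hzu, hux⟩ := exists_between (show z < x from hzx)
  obtain ⟨d, hd0, hd⟩ := exists_between (sub_pos.2 (hBm hux))
  filter_upwards [(hA z).eventually (lt_mem_nhds hzc),
    ((hB x).sub (hB u)).eventually (lt_mem_nhds hd), hs.eventually_ge_atTop 0,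
    (tendsto_exp_neg_mul hs (sub_pos.2 hzu)).eventually (gt_mem_nhds hd0)] with n h1 h2 h3 h4
  refine h1.trans_le (sum_le_topSum _ ?_)
  have hz0 := levelSize_pos (h n) (s n) z
  have hu0 := levelSize_pos (h n) (s n) u
  have hzu' : levelSize (h n) (s n) u = Real.exp (-(s n * (u - z))) * levelSize (h n) (s n) z := by
    rw [← levelSize_add, add_sub_cancel]
  set θz := levelSize (h n) (s n) z
  set θu := levelSize (h n) (s n) u
  set θx := levelSize (h n) (s n) x
  have c1 : ((Finset.univ.filter fun a => θz ≤ p n a).card : ℝ) * θz ≤ 1 := by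
    rw [← nsmul_eq_mul]
    refine (Finset.card_nsmul_le_sum _ (p n) _ fun a ha => (Finset.mem_filter.1 ha).2).trans ?_
    rw [← (hp n).2]
    exact Finset.sum_le_sum_of_subset_of_nonneg (Finset.subset_univ _) fun a _ _ => (hp n).1 a
  have c2 : levelMass (q n) θx - levelMass (q n) θu ≤
      ((Finset.univ.filter fun y => θx ≤ q n y).card : ℝ) * θu := by
    rw [← sum_level_sdiff _ (levelSize_antitone h3 hux.le), ← nsmul_eq_mul]
    refine (Finset.sum_le_card_nsmul _ (q n) θu fun a ha => (Finset.mem_filter.1 ha).2.2.le).trans ?_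
    refine nsmul_le_nsmul_left hu0.le (Finset.card_le_card ?_)
    exact Finset.monotone_filter_right _ fun y _ hy => hy.1
  have c3 : ((Finset.univ.filter fun a => θz ≤ p n a).card : ℝ) * θu ≤
      ((Finset.univ.filter fun y => θx ≤ q n y).card : ℝ) * θu := by
    calc _ = Real.exp (-(s n * (u - z))) *
          (((Finset.univ.filter fun a => θz ≤ p n a).card : ℝ) * θz) := by rw [hzu']; ring
      _ ≤ Real.exp (-(s n * (u - z))) * 1 := mul_le_mul_of_nonneg_left c1 (Real.exp_pos _).le
      _ ≤ _ := by linarith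
  exact_mod_cast le_of_mul_le_mul_right c3 hu0

lemma sqrt_add_le_add_sqrt {x y : ℝ} (hx : 0 ≤ x) (hy : 0 ≤ y) : √(x + y) ≤ √x + √y := by
  rw [Real.sqrt_le_left (by positivity)]
  nlinarith [Real.sq_sqrt hx, Real.sq_sqrt hy, mul_nonneg (Real.sqrt_nonneg x) (Real.sqrt_nonneg y)]

/-- The sequence `0, F 0, …, F k, 1, 1, …`. -/
def cumul (F : ℕ → ℝ) (k : ℕ) : ℕ → ℝ
  | 0 => 0
  | i + 1 => if i ≤ k then F i else 1

lemma eventually_FM_le (hp : ∀ n, IsProb (p n)) (hq : ∀ n, IsProb (q n))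
    (hs : Tendsto s atTop atTop)
    (hA : ∀ z, Tendsto (fun n => levelMass (p n) (levelSize (h n) (s n) z)) atTop (nhds (A z)))
    (hB : ∀ z, Tendsto (fun n => levelMass (q n) (levelSize (h n) (s n) z)) atTop (nhds (B z)))
    (hAc : Continuous A) (hBm : StrictMono B) {x : ℕ → ℝ} (hx : Monotone x) (k : ℕ) {a b : ℕ → ℝ}
    (ha : a = cumul (fun i => A (x i)) k) (hb : b = cumul (fun i => B (x i)) k)
    (ha0 : ∀ i ≤ k + 1, 0 < a (i + 1) - a i) (hb0 : ∀ i ≤ k + 1, 0 < b (i + 1) - b i)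
    (hmono : ∀ i < k + 1, (b (i + 1) - b i) / (a (i + 1) - a i) ≤
      (b (i + 2) - b (i + 1)) / (a (i + 2) - a (i + 1)))
    {c : ℝ} (hc : ∑ i ∈ Finset.range (k + 2), √((a (i + 1) - a i) * (b (i + 1) - b i)) < c) :
    ∀ᶠ n in atTop, FM (p n) (q n) ≤ c := by
  classical
  set G := √((b (k + 1 + 1) - b (k + 1)) / (a (k + 1 + 1) - a (k + 1))) with hG
  have hG0 : 0 ≤ G := Real.sqrt_nonneg _
  set tot := ∑ i ∈ Finset.range (k + 2), √((a (i + 1) - a i) * (b (i + 1) - b i))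
  obtain ⟨ε, hε, hεc⟩ : ∃ ε > 0, tot + ε * G + ε < c := by
    refine ⟨(c - tot) / (2 * (G + 1)), by apply div_pos <;> linarith, ?_⟩
    have : (c - tot) / (2 * (G + 1)) * (G + 1) = (c - tot) / 2 := by
      field_simp
    linarith
  let S : ∀ n, ℕ → Finset (Y n) := fun n i => match i with
    | 0 => ∅
    | i + 1 => if i ≤ k then Finset.univ.filter fun y => levelSize (h n) (s n) (x i) ≤ q n y
      else Finset.univ
  have hSq : ∀ i, Tendsto (fun n => ∑ y ∈ S n i, q n y) atTop (nhds (b i)) := by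
    intro i
    rcases i with _ | i
    · simp [S, hb, cumul]
    · by_cases hi : i ≤ k
      · simpa [S, hb, cumul, hi, levelMass] using hB (x i)
      · simp [S, hb, cumul, hi, (hq _).2]
  have h1 : ∀ᶠ n in atTop, ∀ i ∈ Finset.range (k + 1), A (x i) - ε < topSum (p n)
      (Finset.univ.filter fun y => levelSize (h n) (s n) (x i) ≤ q n y).card := by
    rw [Filter.eventually_all_finset]
    exact fun i _ => eventually_lt_topSum hp hs hA hB hAc hBm (x i) (by linarith)
  have h2 : Tendsto (fun n => ∑ i ∈ Finset.range (k + 2),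
      √|(∑ y ∈ S n (i + 1), q n y - ∑ y ∈ S n i, q n y) - (b (i + 1) - b i)|) atTop (nhds 0) := by
    have : ∀ i ∈ Finset.range (k + 2), Tendsto (fun n =>
      √|(∑ y ∈ S n (i + 1), q n y - ∑ y ∈ S n i, q n y) - (b (i + 1) - b i)|) atTop (nhds 0) := by
      intro i _
      have := (((hSq (i + 1)).sub (hSq i)).sub_const (b (i + 1) - b i)).abs.sqrt
      simpa using this
    simpa using tendsto_finsetSum _ this
  filter_upwards [h1, h2.eventually (gt_mem_nhds hε), hs.eventually_ge_atTop 0] with n h1 h2 hs0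
  have hSm : Monotone (S n) := by
    refine monotone_nat_of_le_succ fun i => ?_
    rcases i with _ | i
    · simp [S]
    · by_cases hi : i + 1 ≤ k
      · have hi' : i ≤ k := by omega
        simp only [S, hi, hi', if_true]
        exact Finset.monotone_filter_right _ fun y _ hy =>
          (levelSize_antitone hs0 (hx i.le_succ)).trans hy
      · simp only [S, hi, if_false]
        exact Finset.subset_univ _
  refine FM_le (hp n) (hq n) fun R hR hM => ?_
  obtain ⟨F, hFm, hF0, hF1, hFt, hF⟩ := exists_coarse_bound (hq n) hR hM (S n) hSm rfl
    (K := k + 2) (by simp [S]) (by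
      intro i y hy z hz
      rcases i with _ | i
      · simp [S] at hy
      · by_cases hi : i ≤ k
        · simp [S, hi] at hy hz
          linarith
        · simp [S, hi] at hz)
  have hFk : ∀ i, k + 1 ≤ i → F (i + 1) ≥ 1 := fun i hi => hF1 ▸ hFm (by omega)
  have hFa : ∀ i, a i - ε ≤ F i := by
    intro i
    rcases i with _ | i
    · simp [ha, cumul, hF0, hε.le]
    · by_cases hi : i ≤ k
      · have e1 := (h1 i (by simp; omega)).le.trans (by simpa [S, hi] using hFt (i + 1))
        simpa [ha, cumul, hi] using e1
      · have := hFk i (by omega)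
        simp only [ha, cumul, hi, if_false]
        linarith
  have key := sum_sqrt_le_of_dominated (F := F) (A := a) (B := b) hε.le (k + 1) hFm
    (by simp [hF0, ha, cumul]) (by simp [hF1, ha, cumul]) hFa ha0 hb0 hmono
  have hterm : ∀ i ∈ Finset.range (k + 2),
      √((F (i + 1) - F i) * (∑ y ∈ S n (i + 1), q n y - ∑ y ∈ S n i, q n y)) ≤
      √((F (i + 1) - F i) * (b (i + 1) - b i)) +
      √|(∑ y ∈ S n (i + 1), q n y - ∑ y ∈ S n i, q n y) - (b (i + 1) - b i)| := by
    intro i hi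
    have hi' := Finset.mem_range.1 hi
    have f0 : 0 ≤ F (i + 1) - F i := sub_nonneg.2 (hFm i.le_succ)
    have f1 : F (i + 1) - F i ≤ 1 := by
      have e1 : F (i + 1) ≤ F (k + 2) := hFm (by omega)
      have e2 : F 0 ≤ F i := hFm (by omega)
      linarith
    refine le_trans (Real.sqrt_le_sqrt ?_) (sqrt_add_le_add_sqrt ?_ (abs_nonneg _))
    · set u := ∑ y ∈ S n (i + 1), q n y - ∑ y ∈ S n i, q n y
      set v := b (i + 1) - b i
      have e1 : (F (i + 1) - F i) * (u - v) ≤ |u - v| :=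
        (mul_le_mul_of_nonneg_left (le_abs_self _) f0).trans
          (mul_le_of_le_one_left (abs_nonneg _) f1)
      linarith
    · exact mul_nonneg f0 (hb0 i (by omega)).le
  have := Finset.sum_le_sum hterm
  rw [Finset.sum_add_distrib] at this
  linarith

end Asymptotic

/-- The integral of `f` over `(-∞, x]`. -/
noncomputable def lowerIntegral (f : ℝ → ℝ) (x : ℝ) : ℝ := ∫ t in Set.Iic x, f t

lemma continuous_lowerIntegral {f : ℝ → ℝ} (hf : Integrable f) : Continuous (lowerIntegral f) :=
  continuous_setIntegral_Iic hf

lemma lowerIntegral_const_mul (c : ℝ) (f : ℝ → ℝ) (x : ℝ) :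
    lowerIntegral (fun t => c * f t) x = c * lowerIntegral f x :=
  integral_const_mul c f

lemma lowerIntegral_sub {f : ℝ → ℝ} (hf : Integrable f) (x y : ℝ) :
    lowerIntegral f y - lowerIntegral f x = ∫ t in x..y, f t :=
  intervalIntegral.integral_Iic_sub_Iic hf.integrableOn hf.integrableOn

lemma lowerIntegral_sub_le {f g : ℝ → ℝ} (hf : Integrable f) (hg : Integrable g) {x y : ℝ}
    (hxy : x ≤ y) (h : ∀ t ∈ Set.Icc x y, f t ≤ g t) :
    lowerIntegral f y - lowerIntegral f x ≤ lowerIntegral g y - lowerIntegral g x := by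
  rw [lowerIntegral_sub hf, lowerIntegral_sub hg]
  exact intervalIntegral.integral_mono_on hxy hf.intervalIntegrable hg.intervalIntegrable h

lemma lowerIntegral_sub_le_mul {f : ℝ → ℝ} (hf : Integrable f) {M : ℝ} (hM : ∀ t, f t ≤ M)
    {x y : ℝ} (hxy : x ≤ y) :
    lowerIntegral f y - lowerIntegral f x ≤ M * (y - x) := by
  rw [lowerIntegral_sub hf]
  refine (intervalIntegral.integral_mono_on hxy hf.intervalIntegrable
    (g := fun _ => M) (by simp) fun t _ => hM t).trans_eq ?_
  simp [mul_comm]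

lemma integral_sub_lowerIntegral {f : ℝ → ℝ} (hf : Integrable f) (x : ℝ) :
    (∫ t, f t) - lowerIntegral f x = ∫ t in Set.Ioi x, f t := by
  unfold lowerIntegral
  rw [← intervalIntegral.integral_Iic_add_Ioi hf.integrableOn hf.integrableOn (b := x)]
  ring

lemma integral_sub_lowerIntegral_le {f g : ℝ → ℝ} (hf : Integrable f) (hg : Integrable g) {x : ℝ}
    (h : ∀ t > x, f t ≤ g t) :
    (∫ t, f t) - lowerIntegral f x ≤ (∫ t, g t) - lowerIntegral g x := by
  rw [integral_sub_lowerIntegral hf, integral_sub_lowerIntegral hg]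
  exact setIntegral_mono_on hf.integrableOn hg.integrableOn measurableSet_Ioi h

lemma strictMono_lowerIntegral {f : ℝ → ℝ} (hf : Integrable f) (hf0 : ∀ t, 0 < f t) :
    StrictMono (lowerIntegral f) := fun x y hxy => by
  rw [← sub_pos, lowerIntegral_sub hf]
  exact intervalIntegral.intervalIntegral_pos_of_pos hf.intervalIntegrable hf0 hxy

lemma tendsto_lowerIntegral_atTop {f : ℝ → ℝ} (hf : Integrable f) :
    Tendsto (lowerIntegral f) atTop (nhds (∫ t, f t)) :=
  (aecover_Iic tendsto_id).integral_tendsto_of_countably_generated hf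

lemma tendsto_lowerIntegral_atBot {f : ℝ → ℝ} (hf : Integrable f) :
    Tendsto (lowerIntegral f) atBot (nhds 0) := by
  have h : Tendsto (fun x => ∫ t in Set.Ioi x, f t) atBot (nhds (∫ t, f t)) :=
    (aecover_Ioi tendsto_id).integral_tendsto_of_countably_generated hf
  have h2 := h.const_sub (∫ t, f t)
  rw [sub_self] at h2
  refine h2.congr fun x => ?_
  rw [← integral_sub_lowerIntegral hf]
  ring

lemma lowerIntegral_pos {f : ℝ → ℝ} (hf : Integrable f) (hf0 : ∀ t, 0 < f t) (x : ℝ) :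
    0 < lowerIntegral f x := by
  refine lt_of_le_of_lt ?_ (strictMono_lowerIntegral hf hf0 (sub_one_lt x))
  exact integral_nonneg fun t => (hf0 t).le

lemma lowerIntegral_lt_integral {f : ℝ → ℝ} (hf : Integrable f) (hf0 : ∀ t, 0 < f t) (x : ℝ) :
    lowerIntegral f x < ∫ t, f t := by
  refine (strictMono_lowerIntegral hf hf0 (lt_add_one x)).trans_le ?_
  exact setIntegral_le_integral hf (Eventually.of_forall fun t => (hf0 t).le)

lemma sum_grid_le {g F : ℕ → ℝ} (k : ℕ) (hg : ∀ i < k, g (i + 1) ≤ g i) (hgk : 0 ≤ g k) {w : ℝ}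
    (hw : 0 ≤ w) (hF : ∀ i < k, F (i + 1) - F i ≤ w) :
    ∑ i ∈ Finset.range k, g i * (F (i + 1) - F i) ≤
      ∑ i ∈ Finset.range k, g (i + 1) * (F (i + 1) - F i) + w * g 0 := by
  have h1 : ∑ i ∈ Finset.range k, (g i - g (i + 1)) * (F (i + 1) - F i) ≤
      ∑ i ∈ Finset.range k, (g i - g (i + 1)) * w := by
    refine Finset.sum_le_sum fun i hi => ?_
    have hi := Finset.mem_range.1 hi
    exact mul_le_mul_of_nonneg_left (hF i hi) (sub_nonneg.2 (hg i hi))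
  rw [← Finset.sum_mul, Finset.sum_range_sub'] at h1
  simp only [sub_mul (g _) (g _), Finset.sum_sub_distrib] at h1
  nlinarith

/-- Two probability densities whose ratio `a / d` decreases up to `β` and crosses at `β` the ratio
of the upper tails. -/
structure DensityCrossing (a d : ℝ → ℝ) (M β : ℝ) : Prop where
  pos_left : ∀ t, 0 < a t
  pos_right : ∀ t, 0 < d t
  integrable_left : Integrable a
  integrable_right : Integrable d
  integral_left : ∫ t, a t = 1
  integral_right : ∫ t, d t = 1
  le_left : ∀ t, a t ≤ M
  le_right : ∀ t, d t ≤ M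
  antitoneOn : AntitoneOn (fun t => a t / d t) (Set.Iic β)
  crossing : 1 - lowerIntegral a β = a β / d β * (1 - lowerIntegral d β)
  tail_le : ∀ x ≥ β, a β / d β * (1 - lowerIntegral d x) ≤ 1 - lowerIntegral a x

namespace DensityCrossing

variable {a d : ℝ → ℝ} {M β : ℝ}

lemma ratio_pos (hc : DensityCrossing a d M β) (t : ℝ) : 0 < a t / d t :=
  div_pos (hc.pos_left t) (hc.pos_right t)

lemma ratio_mul (hc : DensityCrossing a d M β) (t : ℝ) : a t / d t * d t = a t :=
  div_mul_cancel₀ _ (hc.pos_right t).ne'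

lemma sqrt_mul_eq (hc : DensityCrossing a d M β) (t : ℝ) :
    √(a t * d t) = √(a t / d t) * d t := by
  conv_lhs => rw [← hc.ratio_mul t, mul_assoc,
    Real.sqrt_mul' _ (mul_self_nonneg _), Real.sqrt_mul_self (hc.pos_right t).le]

lemma integrable_sqrt (hc : DensityCrossing a d M β) : Integrable fun t => √(a t * d t) := by
  refine (hc.integrable_left.add hc.integrable_right).mono' ?_ (Eventually.of_forall fun t => ?_)
  · exact Real.continuous_sqrt.comp_aestronglyMeasurable
      (hc.integrable_left.aestronglyMeasurable.mul hc.integrable_right.aestronglyMeasurable)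
  · have h1 := hc.pos_left t
    have h2 := hc.pos_right t
    rw [Real.norm_of_nonneg (Real.sqrt_nonneg _), Real.sqrt_le_left (by simp; linarith)]
    simp only [Pi.add_apply]
    nlinarith

lemma pos_bound (hc : DensityCrossing a d M β) : 0 < M := (hc.pos_left 0).trans_le (hc.le_left 0)

lemma lowerIntegral_left_lt_one (hc : DensityCrossing a d M β) (x : ℝ) : lowerIntegral a x < 1 :=
  hc.integral_left ▸ lowerIntegral_lt_integral hc.integrable_left hc.pos_left x

lemma lowerIntegral_right_lt_one (hc : DensityCrossing a d M β) (x : ℝ) : lowerIntegral d x < 1 :=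
  hc.integral_right ▸ lowerIntegral_lt_integral hc.integrable_right hc.pos_right x

lemma ratio_mul_sub_le (hc : DensityCrossing a d M β) {x y : ℝ} (hxy : x ≤ y) (hy : y ≤ β) :
    a y / d y * (lowerIntegral d y - lowerIntegral d x) ≤
      lowerIntegral a y - lowerIntegral a x := by
  rw [mul_sub, ← lowerIntegral_const_mul, ← lowerIntegral_const_mul]
  refine lowerIntegral_sub_le (hc.integrable_right.const_mul _) hc.integrable_left hxy
    fun t ht => ?_
  rw [← hc.ratio_mul t]
  exact mul_le_mul_of_nonneg_right (hc.antitoneOn (ht.2.trans hy) hy ht.2) (hc.pos_right t).le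

lemma sub_le_ratio_mul (hc : DensityCrossing a d M β) {x y : ℝ} (hxy : x ≤ y) (hy : y ≤ β) :
    lowerIntegral a y - lowerIntegral a x ≤
      a x / d x * (lowerIntegral d y - lowerIntegral d x) := by
  rw [mul_sub, ← lowerIntegral_const_mul, ← lowerIntegral_const_mul]
  refine lowerIntegral_sub_le hc.integrable_left (hc.integrable_right.const_mul _) hxy
    fun t ht => ?_
  rw [← hc.ratio_mul t]
  exact mul_le_mul_of_nonneg_right (hc.antitoneOn (hxy.trans hy) (ht.2.trans hy) ht.1)
    (hc.pos_right t).le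

lemma sqrt_ratio_mul_sub_le (hc : DensityCrossing a d M β) {x y : ℝ} (hxy : x ≤ y) (hy : y ≤ β) :
    √(a y / d y) * (lowerIntegral d y - lowerIntegral d x) ≤
      lowerIntegral (fun t => √(a t * d t)) y - lowerIntegral (fun t => √(a t * d t)) x := by
  rw [mul_sub, ← lowerIntegral_const_mul, ← lowerIntegral_const_mul]
  refine lowerIntegral_sub_le (hc.integrable_right.const_mul _) hc.integrable_sqrt hxy
    fun t ht => ?_
  rw [hc.sqrt_mul_eq t]
  exact mul_le_mul_of_nonneg_right
    (Real.sqrt_le_sqrt (hc.antitoneOn (ht.2.trans hy) hy ht.2)) (hc.pos_right t).le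

lemma sub_le_sqrt_ratio_mul (hc : DensityCrossing a d M β) {x y : ℝ} (hxy : x ≤ y) (hy : y ≤ β) :
    lowerIntegral (fun t => √(a t * d t)) y - lowerIntegral (fun t => √(a t * d t)) x ≤
      √(a x / d x) * (lowerIntegral d y - lowerIntegral d x) := by
  rw [mul_sub, ← lowerIntegral_const_mul, ← lowerIntegral_const_mul]
  refine lowerIntegral_sub_le hc.integrable_sqrt (hc.integrable_right.const_mul _) hxy
    fun t ht => ?_
  rw [hc.sqrt_mul_eq t]
  exact mul_le_mul_of_nonneg_right
    (Real.sqrt_le_sqrt (hc.antitoneOn (hxy.trans hy) (ht.2.trans hy) ht.1)) (hc.pos_right t).le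

lemma ratio_mul_lowerIntegral_le (hc : DensityCrossing a d M β) {x : ℝ} (hx : x ≤ β) :
    a x / d x * lowerIntegral d x ≤ lowerIntegral a x := by
  rw [← lowerIntegral_const_mul]
  refine setIntegral_mono_on (hc.integrable_right.const_mul _).integrableOn
    hc.integrable_left.integrableOn measurableSet_Iic fun t ht => ?_
  rw [← hc.ratio_mul t]
  exact mul_le_mul_of_nonneg_right (hc.antitoneOn (le_trans ht hx) hx ht) (hc.pos_right t).le

lemma sqrt_tail (hc : DensityCrossing a d M β) :
    √((1 - lowerIntegral a β) * (1 - lowerIntegral d β)) =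
      √(a β / d β) * (1 - lowerIntegral d β) := by
  rw [hc.crossing, mul_assoc, Real.sqrt_mul' _ (mul_self_nonneg _),
    Real.sqrt_mul_self (sub_nonneg.2 (hc.lowerIntegral_right_lt_one β).le)]

section Asymptotic

variable {X Y : ℕ → Type*} [∀ n, Fintype (X n)] [∀ n, Fintype (Y n)]
  {p : ∀ n, X n → ℝ} {q : ∀ n, Y n → ℝ} {h s : ℕ → ℝ}

lemma eventually_lt_FD (hc : DensityCrossing a d M β) (hp : ∀ n, IsProb (p n))
    (hq : ∀ n, IsProb (q n)) (hs : Tendsto s atTop atTop)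
    (hA : ∀ z, Tendsto (fun n => levelMass (p n) (levelSize (h n) (s n) z)) atTop
      (nhds (lowerIntegral a z)))
    (hB : ∀ z, Tendsto (fun n => levelMass (q n) (levelSize (h n) (s n) z)) atTop
      (nhds (lowerIntegral d z)))
    {c : ℝ} (hlt : c < lowerIntegral (fun t => √(a t * d t)) β +
      √((1 - lowerIntegral a β) * (1 - lowerIntegral d β))) :
    ∀ᶠ n in atTop, c < FD (p n) (q n) := by
  have hAm := strictMono_lowerIntegral hc.integrable_left hc.pos_left
  have hBm := strictMono_lowerIntegral hc.integrable_right hc.pos_right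
  have hM := hc.pos_bound
  rw [hc.sqrt_tail] at hlt
  obtain ⟨R, hR, hRc⟩ : ∃ R > 0, c < (lowerIntegral (fun t => √(a t * d t)) β -
      lowerIntegral (fun t => √(a t * d t)) (β - R)) +
      √(a β / d β) * (lowerIntegral d (β + R) - lowerIntegral d β) := by
    have t1 : Tendsto (fun R : ℝ => lowerIntegral (fun t => √(a t * d t)) (β - R)) atTop
        (nhds 0) := (tendsto_lowerIntegral_atBot hc.integrable_sqrt).comp
      (tendsto_atBot_add_const_left atTop β tendsto_neg_atTop_atBot)
    have t2 : Tendsto (fun R : ℝ => lowerIntegral d (β + R)) atTop (nhds 1) :=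
      hc.integral_right ▸ (tendsto_lowerIntegral_atTop hc.integrable_right).comp
        (tendsto_atTop_add_const_left atTop β tendsto_id)
    have t3 := (t1.const_sub (lowerIntegral (fun t => √(a t * d t)) β)).add
      ((t2.sub_const (lowerIntegral d β)).const_mul √(a β / d β))
    rw [sub_zero] at t3
    exact ((eventually_gt_atTop 0).and (t3.eventually (lt_mem_nhds hlt))).exists
  set x₀ := β - R with hx₀
  set E := (lowerIntegral (fun t => √(a t * d t)) β -
      lowerIntegral (fun t => √(a t * d t)) x₀) +
      √(a β / d β) * (lowerIntegral d (β + R) - lowerIntegral d β) with hE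
  obtain ⟨η, ⟨hη0, hη1⟩, hη⟩ : ∃ η, (0 < η ∧ η < 1) ∧ c < √(1 - η) * (E - η * √(a x₀ / d x₀)) := by
    have t1 : ContinuousAt (fun η : ℝ => √(1 - η) * (E - η * √(a x₀ / d x₀))) 0 := by fun_prop
    have t2 : ∀ᶠ η in nhdsWithin (0 : ℝ) (Set.Ioi 0), c < √(1 - η) * (E - η * √(a x₀ / d x₀)) :=
      (t1.eventually (lt_mem_nhds (by simpa using hRc))).filter_mono nhdsWithin_le_nhds
    have t3 : ∀ᶠ η in nhdsWithin (0 : ℝ) (Set.Ioi 0), 0 < η ∧ η < 1 := Ioo_mem_nhdsGT one_pos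
    exact (t3.and t2).exists
  have hAR := sub_pos.2 (hc.lowerIntegral_left_lt_one (β + R))
  obtain ⟨k, hk⟩ := exists_nat_gt (max (M * R / η)
    (M * (2 * R) / (η * (1 - lowerIntegral a (β + R)))))
  have hk1 := (le_max_left _ _).trans_lt hk
  have hk2 := (le_max_right _ _).trans_lt hk
  have hk0 : (0 : ℝ) < k := lt_of_le_of_lt (by positivity) hk1
  rw [div_lt_iff₀ hη0] at hk1
  rw [div_lt_iff₀ (by positivity)] at hk2
  obtain ⟨w, hw⟩ : ∃ w, w = R / k := ⟨_, rfl⟩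
  have hkw : k * w = R := by rw [hw]; field_simp
  have hw0 : 0 < w := hw ▸ div_pos hR hk0
  have hMw : M * w ≤ η := by
    refine le_of_mul_le_mul_left ?_ hk0
    nlinarith
  have hMw2 : M * (2 * w) < η * (1 - lowerIntegral a (β + R)) := by
    refine lt_of_mul_lt_mul_left ?_ hk0.le
    nlinarith
  set x : ℕ → ℝ := fun i => x₀ + i * w with hx
  have hxs : ∀ i, x (i + 1) = x i + w := fun i => by simp only [hx]; push_cast; ring
  have hxm : Monotone x := monotone_nat_of_le_succ fun i => by rw [hxs]; linarith
  have hx0 : x 0 = x₀ := by simp [hx]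
  have hxk : x k = β := by simp only [hx]; linarith
  have hx2k : x (2 * k) = β + R := by simp only [hx]; push_cast; linarith
  have hBd : ∀ i, lowerIntegral d (x (i + 1)) - lowerIntegral d (x i) ≤ M * w := fun i => by
    refine (lowerIntegral_sub_le_mul hc.integrable_right hc.le_right (hxm i.le_succ)).trans_eq ?_
    rw [hxs]; ring
  have hB0 : ∀ i, 0 ≤ lowerIntegral d (x (i + 1)) - lowerIntegral d (x i) := fun i =>
    sub_nonneg.2 (hBm.monotone (hxm i.le_succ))
  have hlow : ∀ j < k, min (x (j + 1)) β = x (j + 1) := fun j hj =>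
    min_eq_left (hxk ▸ hxm (Nat.succ_le_of_lt hj))
  have hhigh : ∀ j, k ≤ j → min (x (j + 1)) β = β := fun j hj =>
    min_eq_right (hxk ▸ hxm (by omega))
  set r : ℕ → ℝ := fun j => a (min (x (j + 1)) β) / d (min (x (j + 1)) β) with hr
  have hhighsum : ∀ i, k ≤ i → i ≤ 2 * k → ∑ j ∈ Finset.Ico i (2 * k),
      r j * (lowerIntegral d (x (j + 1)) - lowerIntegral d (x j)) ≤ 1 - lowerIntegral a (x i) := by
    intro i hi hi2
    have e : ∀ j ∈ Finset.Ico i (2 * k), r j * (lowerIntegral d (x (j + 1)) -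
        lowerIntegral d (x j)) =
        a β / d β * (lowerIntegral d (x (j + 1)) - lowerIntegral d (x j)) := fun j hj => by
      simp only [hr, hhigh j (hi.trans (Finset.mem_Ico.1 hj).1)]
    rw [Finset.sum_congr rfl e, ← Finset.mul_sum,
      Finset.sum_Ico_sub (fun j => lowerIntegral d (x j)) hi2]
    refine le_trans (mul_le_mul_of_nonneg_left ?_ (hc.ratio_pos β).le)
      (hc.tail_le (x i) (hxk ▸ hxm hi))
    exact sub_le_sub_right (hc.lowerIntegral_right_lt_one _).le _
  have hsum : ∀ i ≤ 2 * k, ∑ j ∈ Finset.Ico i (2 * k),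
      r j * (lowerIntegral d (x (j + 1)) - lowerIntegral d (x j)) ≤ 1 - lowerIntegral a (x i) := by
    intro i hi2
    rcases le_total k i with hi | hi
    · exact hhighsum i hi hi2
    rw [← Finset.sum_Ico_consecutive _ hi (by omega : k ≤ 2 * k)]
    have e : ∑ j ∈ Finset.Ico i k, r j * (lowerIntegral d (x (j + 1)) - lowerIntegral d (x j)) ≤
        ∑ j ∈ Finset.Ico i k, (lowerIntegral a (x (j + 1)) - lowerIntegral a (x j)) := by
      refine Finset.sum_le_sum fun j hj => ?_
      have hj := (Finset.mem_Ico.1 hj).2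
      simp only [hr, hlow j hj]
      exact hc.ratio_mul_sub_le (hxm j.le_succ) (hxk ▸ hxm hj)
    rw [Finset.sum_Ico_sub (fun j => lowerIntegral a (x j)) hi] at e
    linarith [hhighsum k le_rfl (by omega)]
  refine RNG.eventually_lt_FD hp hq hs hA hB hxm (2 * k) (l := fun i => (1 - η) * r i)
    (fun i => mul_nonneg (by linarith) (hc.ratio_pos _).le) hw0 ?_ ?_
  · intro i hi
    simp only [mul_assoc, ← Finset.mul_sum]
    have e1 := mul_le_mul_of_nonneg_left (hsum i hi.le) (by linarith : 0 ≤ 1 - η)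
    have e2 := lowerIntegral_sub_le_mul hc.integrable_left hc.le_left
      (by rw [hxs]; linarith : x i ≤ x (i + 1) + w)
    have e3 : lowerIntegral a (x i) ≤ lowerIntegral a (β + R) :=
      hAm.monotone (hx2k ▸ hxm hi.le)
    have e4 : x (i + 1) + w - x i = 2 * w := by rw [hxs]; ring
    rw [e4] at e2
    nlinarith
  · refine hη.trans_le ?_
    simp only [Real.sqrt_mul (by linarith : 0 ≤ 1 - η), mul_assoc, ← Finset.mul_sum]
    refine mul_le_mul_of_nonneg_left ?_ (Real.sqrt_nonneg _)
    rw [Finset.range_eq_Ico, ← Finset.sum_Ico_consecutive _ (Nat.zero_le k) (by omega : k ≤ 2 * k),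
      ← Finset.range_eq_Ico]
    have e1 : ∑ i ∈ Finset.Ico k (2 * k), √(r i) *
        (lowerIntegral d (x (i + 1)) - lowerIntegral d (x i)) =
        √(a β / d β) * (lowerIntegral d (β + R) - lowerIntegral d β) := by
      rw [← hx2k]
      conv_rhs => rw [← hxk, ← Finset.sum_Ico_sub (fun j => lowerIntegral d (x j))
        (by omega : k ≤ 2 * k), Finset.mul_sum, hxk]
      refine Finset.sum_congr rfl fun j hj => ?_
      simp only [hr, hhigh j (Finset.mem_Ico.1 hj).1]
    have e2 : ∑ i ∈ Finset.range k, √(r i) *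
        (lowerIntegral d (x (i + 1)) - lowerIntegral d (x i)) =
        ∑ i ∈ Finset.range k, √(a (x (i + 1)) / d (x (i + 1))) *
          (lowerIntegral d (x (i + 1)) - lowerIntegral d (x i)) := by
      refine Finset.sum_congr rfl fun j hj => ?_
      simp only [hr, hlow j (Finset.mem_range.1 hj)]
    have e3 := sum_grid_le (g := fun i => √(a (x i) / d (x i)))
      (F := fun i => lowerIntegral d (x i)) k
      (fun i hi => Real.sqrt_le_sqrt (hc.antitoneOn
        (hxk ▸ hxm hi.le : x i ≤ β) (hxk ▸ hxm hi : x (i + 1) ≤ β) (hxm i.le_succ)))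
      (Real.sqrt_nonneg _) (by positivity) (fun i _ => hBd i)
    have e4 := Finset.sum_le_sum fun i (hi : i ∈ Finset.range k) =>
      hc.sub_le_sqrt_ratio_mul (hxm i.le_succ)
        (hxk ▸ hxm (Finset.mem_range.1 hi) : x (i + 1) ≤ β)
    rw [Finset.sum_range_sub (fun i => lowerIntegral (fun t => √(a t * d t)) (x i)), hxk, hx0] at e4
    have e5 := mul_le_mul_of_nonneg_right hMw (Real.sqrt_nonneg (a x₀ / d x₀))
    simp only [hx0] at e3
    rw [e1, e2]
    linarith

end Asymptotic

end DensityCrossing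

namespace DensityCrossing

variable {a d : ℝ → ℝ} {M β : ℝ} {X Y : ℕ → Type*} [∀ n, Fintype (X n)] [∀ n, Fintype (Y n)]
  {p : ∀ n, X n → ℝ} {q : ∀ n, Y n → ℝ} {h s : ℕ → ℝ}

lemma eventually_FM_le (hc : DensityCrossing a d M β) (hp : ∀ n, IsProb (p n))
    (hq : ∀ n, IsProb (q n)) (hs : Tendsto s atTop atTop)
    (hA : ∀ z, Tendsto (fun n => levelMass (p n) (levelSize (h n) (s n) z)) atTop
      (nhds (lowerIntegral a z)))
    (hB : ∀ z, Tendsto (fun n => levelMass (q n) (levelSize (h n) (s n) z)) atTop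
      (nhds (lowerIntegral d z)))
    {c : ℝ} (hlt : lowerIntegral (fun t => √(a t * d t)) β +
      √((1 - lowerIntegral a β) * (1 - lowerIntegral d β)) < c) :
    ∀ᶠ n in atTop, FM (p n) (q n) ≤ c := by
  have hAm := strictMono_lowerIntegral hc.integrable_left hc.pos_left
  have hBm := strictMono_lowerIntegral hc.integrable_right hc.pos_right
  have hM := hc.pos_bound
  set τ := lowerIntegral (fun t => √(a t * d t)) β +
      √((1 - lowerIntegral a β) * (1 - lowerIntegral d β)) with hτ
  obtain ⟨R, hR, hRc⟩ : ∃ R > 0, √(lowerIntegral a (β - R)) < (c - τ) / 2 := by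
    have t1 : Tendsto (fun R : ℝ => √(lowerIntegral a (β - R))) atTop (nhds √0) :=
      ((tendsto_lowerIntegral_atBot hc.integrable_left).comp
        (tendsto_atBot_add_const_left atTop β tendsto_neg_atTop_atBot)).sqrt
    rw [Real.sqrt_zero] at t1
    exact ((eventually_gt_atTop 0).and
      (t1.eventually (gt_mem_nhds (by linarith : 0 < (c - τ) / 2)))).exists
  set x₀ := β - R with hx₀
  obtain ⟨k, hk⟩ := exists_nat_gt (M * R * √(a x₀ / d x₀) / ((c - τ) / 2))
  have hk0 : (0 : ℝ) < k := lt_of_le_of_lt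
    (div_nonneg (by positivity) (by linarith)) hk
  rw [div_lt_iff₀ (by linarith)] at hk
  obtain ⟨w, hw⟩ : ∃ w, w = R / k := ⟨_, rfl⟩
  have hkw : k * w = R := by rw [hw]; field_simp
  have hw0 : 0 < w := hw ▸ div_pos hR hk0
  have hMw : M * w * √(a x₀ / d x₀) < (c - τ) / 2 := by
    refine lt_of_mul_lt_mul_left ?_ hk0.le
    rw [← hkw] at hk
    linarith
  set x : ℕ → ℝ := fun i => x₀ + i * w with hx
  have hxs : ∀ i, x (i + 1) = x i + w := fun i => by simp only [hx]; push_cast; ring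
  have hxm : StrictMono x := strictMono_nat_of_lt_succ fun i => by rw [hxs]; linarith
  have hx0 : x 0 = x₀ := by simp [hx]
  have hxk : x k = β := by simp only [hx]; linarith
  have hxβ : ∀ i ≤ k, x i ≤ β := fun i hi => hxk ▸ hxm.monotone hi
  have hBd : ∀ i, lowerIntegral d (x (i + 1)) - lowerIntegral d (x i) ≤ M * w := fun i => by
    refine (lowerIntegral_sub_le_mul hc.integrable_right hc.le_right
      (hxm.monotone i.le_succ)).trans_eq ?_
    rw [hxs]; ring
  have hdiff0 : ∀ F : ℝ → ℝ, cumul (fun i => F (x i)) k (0 + 1) - cumul (fun i => F (x i)) k 0 =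
      F (x 0) := fun F => by simp [cumul]
  have hdiff : ∀ F : ℝ → ℝ, ∀ i < k, cumul (fun i => F (x i)) k (i + 1 + 1) -
      cumul (fun i => F (x i)) k (i + 1) = F (x (i + 1)) - F (x i) := fun F i hi => by
    simp [cumul, hi.le, Nat.succ_le_of_lt hi]
  have hdiffk : ∀ F : ℝ → ℝ, cumul (fun i => F (x i)) k (k + 1 + 1) -
      cumul (fun i => F (x i)) k (k + 1) = 1 - F β := fun F => by
    simp [cumul, hxk]
  have hpos : ∀ F : ℝ → ℝ, StrictMono F → (∀ t, 0 < F t) → (∀ t, F t < 1) → ∀ i ≤ k + 1,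
      0 < cumul (fun i => F (x i)) k (i + 1) - cumul (fun i => F (x i)) k i := by
    intro F hF h0 h1 i hi
    rcases i with _ | i
    · rw [hdiff0]; exact h0 _
    · rcases Nat.lt_or_ge i k with hik | hik
      · rw [hdiff F i hik]; exact sub_pos.2 (hF (hxm i.lt_succ_self))
      · obtain rfl : i = k := by omega
        rw [hdiffk]; exact sub_pos.2 (h1 _)
  have ha0 := hpos _ hAm (lowerIntegral_pos hc.integrable_left hc.pos_left)
    hc.lowerIntegral_left_lt_one
  have hb0 := hpos _ hBm (lowerIntegral_pos hc.integrable_right hc.pos_right)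
    hc.lowerIntegral_right_lt_one
  refine RNG.eventually_FM_le hp hq hs hA hB (continuous_lowerIntegral hc.integrable_left) hBm
    hxm.monotone k rfl rfl ha0 hb0 ?_ ?_
  · intro i hi
    have hi' : i ≤ k := by omega
    rw [div_le_div_iff₀ (ha0 i (by omega)) (ha0 (i + 1) (by omega))]
    have e1 : a (x i) / d (x i) * (cumul (fun i => lowerIntegral d (x i)) k (i + 1) -
        cumul (fun i => lowerIntegral d (x i)) k i) ≤
        cumul (fun i => lowerIntegral a (x i)) k (i + 1) -
        cumul (fun i => lowerIntegral a (x i)) k i := by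
      rcases i with _ | i
      · rw [hdiff0, hdiff0]
        exact hc.ratio_mul_lowerIntegral_le (hxβ 0 hi')
      · rw [hdiff _ i hi', hdiff _ i hi']
        exact hc.ratio_mul_sub_le (hxm.monotone i.le_succ) (hxβ _ hi')
    have e2 : cumul (fun i => lowerIntegral a (x i)) k (i + 1 + 1) -
        cumul (fun i => lowerIntegral a (x i)) k (i + 1) ≤
        a (x i) / d (x i) * (cumul (fun i => lowerIntegral d (x i)) k (i + 1 + 1) -
        cumul (fun i => lowerIntegral d (x i)) k (i + 1)) := by
      rcases Nat.lt_or_ge i k with hik | hik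
      · rw [hdiff _ i hik, hdiff _ i hik]
        exact hc.sub_le_ratio_mul (hxm.monotone i.le_succ) (hxβ _ hik)
      · obtain rfl : i = k := by omega
        rw [hdiffk, hdiffk, hxk]
        exact hc.crossing.le
    have e3 := mul_le_mul_of_nonneg_left e2 (hb0 i (by omega)).le
    have e4 := mul_le_mul_of_nonneg_right e1 (hb0 (i + 1) (by omega)).le
    linarith
  · rw [Finset.sum_range_succ, Finset.sum_range_succ', hdiff0, hdiff0, hdiffk, hdiffk]
    have e1 : √(lowerIntegral a (x 0) * lowerIntegral d (x 0)) ≤ √(lowerIntegral a x₀) := by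
      rw [hx0]
      exact Real.sqrt_le_sqrt (mul_le_of_le_one_right
        (lowerIntegral_pos hc.integrable_left hc.pos_left _).le
        (hc.lowerIntegral_right_lt_one _).le)
    have e2 := Finset.sum_le_sum (s := Finset.range k)
        (f := fun i => √((cumul (fun i => lowerIntegral a (x i)) k (i + 1 + 1) -
          cumul (fun i => lowerIntegral a (x i)) k (i + 1)) *
          (cumul (fun i => lowerIntegral d (x i)) k (i + 1 + 1) -
          cumul (fun i => lowerIntegral d (x i)) k (i + 1))))
        (g := fun i => √(a (x i) / d (x i)) *
          (lowerIntegral d (x (i + 1)) - lowerIntegral d (x i))) (by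
      intro i hi
      have hi := Finset.mem_range.1 hi
      have hB0 := (sub_pos.2 (hBm (hxm i.lt_succ_self))).le
      simp only [hdiff _ i hi]
      refine (Real.sqrt_le_sqrt (mul_le_mul_of_nonneg_right
        (hc.sub_le_ratio_mul (hxm.monotone i.le_succ) (hxβ _ hi)) hB0)).trans_eq ?_
      rw [mul_assoc, Real.sqrt_mul' _ (mul_self_nonneg _), Real.sqrt_mul_self hB0])
    have e3 := sum_grid_le (g := fun i => √(a (x i) / d (x i)))
      (F := fun i => lowerIntegral d (x i)) k
      (fun i hi => Real.sqrt_le_sqrt (hc.antitoneOn (hxβ i hi.le) (hxβ (i + 1) hi)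
        (hxm.monotone i.le_succ)))
      (Real.sqrt_nonneg _) (by positivity) (fun i _ => hBd i)
    have e4 := Finset.sum_le_sum fun i (hi : i ∈ Finset.range k) =>
      hc.sqrt_ratio_mul_sub_le (hxm.monotone i.le_succ) (hxβ (i + 1) (Finset.mem_range.1 hi))
    rw [Finset.sum_range_sub (fun i => lowerIntegral (fun t => √(a t * d t)) (x i)), hxk] at e4
    have e5 : 0 ≤ lowerIntegral (fun t => √(a t * d t)) (x 0) :=
      integral_nonneg fun t => Real.sqrt_nonneg _
    simp only [hx0] at e3
    linarith

end DensityCrossing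

lemma normalPDF_le (m : ℝ) {v : ℝ} (hv : 0 < v) (x : ℝ) :
    normalPDF m v x ≤ (√(2 * Real.pi * v))⁻¹ := by
  refine mul_le_of_le_one_right (by positivity) (Real.exp_le_one_iff.2 ?_)
  rw [neg_div, neg_nonpos]
  positivity

lemma exists_normalPDF_div_eq (m : ℝ) {u v : ℝ} (hv : 0 < v) (hvu : v < u) :
    ∃ K > 0, ∃ q > 0, ∃ x₀, ∀ t,
      normalPDF 0 u t / normalPDF m v t = K * Real.exp (q * (t - x₀) ^ 2) := by
  have hu := hv.trans hvu
  obtain ⟨q, hq⟩ : ∃ q, q = (u - v) / (2 * u * v) := ⟨_, rfl⟩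
  obtain ⟨x₀, hx₀⟩ : ∃ x₀, x₀ = m * u / (u - v) := ⟨_, rfl⟩
  have huv : 0 < u - v := sub_pos.2 hvu
  refine ⟨(√(2 * Real.pi * u))⁻¹ / (√(2 * Real.pi * v))⁻¹ *
    Real.exp (m ^ 2 / (2 * v) - q * x₀ ^ 2), by positivity, q, hq ▸ by positivity, x₀, fun t => ?_⟩
  unfold normalPDF
  rw [mul_div_mul_comm, ← Real.exp_sub, mul_assoc _ (Real.exp _), ← Real.exp_add]
  congr 2
  rw [hq, hx₀]
  field_simp
  ring

lemma densityCrossing_normalPDF (m : ℝ) {u v : ℝ} (hv : 0 < v) (hvu : v < u) {β : ℝ}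
    (hβ : normalPDF 0 u β / normalPDF m v β =
      (1 - lowerIntegral (normalPDF 0 u) β) / (1 - lowerIntegral (normalPDF m v) β)) :
    DensityCrossing (normalPDF 0 u) (normalPDF m v)
      (max (√(2 * Real.pi * u))⁻¹ (√(2 * Real.pi * v))⁻¹) β := by
  have hu := hv.trans hvu
  have ha := integrable_normalPDF 0 hu
  have hd := integrable_normalPDF m hv
  have ha1 := integral_normalPDF 0 hu
  have hd1 := integral_normalPDF m hv
  have hd0 := normalPDF_pos m hv
  obtain ⟨K, hK, q, hq, x₀, hr⟩ := exists_normalPDF_div_eq m hv hvu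
  have hBm := strictMono_lowerIntegral hd hd0
  have hB1 : ∀ x, 0 < 1 - lowerIntegral (normalPDF m v) x := fun x =>
    sub_pos.2 (hd1 ▸ lowerIntegral_lt_integral hd hd0 x)
  rw [eq_div_iff (hB1 β).ne'] at hβ
  set a := normalPDF 0 u
  set d := normalPDF m v
  have hrm : ∀ t, a t / d t * d t = a t := fun t => div_mul_cancel₀ _ (hd0 t).ne'
  have hle : ∀ x y, (x - x₀) ^ 2 ≤ (y - x₀) ^ 2 → a x / d x ≤ a y / d y := by
    intro x y hxy
    rw [hr, hr]
    gcongr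
  have hlt : ∀ x y, (x - x₀) ^ 2 < (y - x₀) ^ 2 → a x / d x < a y / d y := by
    intro x y hxy
    rw [hr, hr]
    gcongr
  have htail : ∀ x c, (∀ t > x, c ≤ a t / d t) →
      c * (1 - lowerIntegral d x) ≤ 1 - lowerIntegral a x := by
    intro x c h
    have := integral_sub_lowerIntegral_le (hd.const_mul c) ha (x := x) fun t ht => by
      rw [← hrm t]
      exact mul_le_mul_of_nonneg_right (h t ht) (hd0 t).le
    rwa [lowerIntegral_const_mul, integral_const_mul, hd1, ha1, ← mul_sub] at this
  have hβx : β < x₀ := by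
    by_contra! h
    have h1 := htail (β + 1) (a (β + 1) / d (β + 1)) fun t ht => hle _ _ (by nlinarith)
    have h2 := lowerIntegral_sub_le (hd.const_mul (a β / d β)) ha (by linarith : β ≤ β + 1)
      fun t ht => by
        rw [← hrm t]
        exact mul_le_mul_of_nonneg_right (hle _ _ (by nlinarith [ht.1])) (hd0 t).le
    rw [lowerIntegral_const_mul, lowerIntegral_const_mul] at h2
    have h3 := mul_lt_mul_of_pos_right (hlt β (β + 1) (by nlinarith)) (hB1 (β + 1))
    linarith
  refine ⟨normalPDF_pos 0 hu, hd0, ha, hd, ha1, hd1,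
    fun t => (normalPDF_le 0 hu t).trans (le_max_left _ _),
    fun t => (normalPDF_le m hv t).trans (le_max_right _ _), ?_, hβ.symm, ?_⟩
  · intro x hx y hy hxy
    have hx' : x ≤ β := hx
    have hy' : y ≤ β := hy
    exact hle _ _ (by nlinarith)
  · intro x hx
    rcases le_total (2 * x₀ - β) x with h | h
    · exact htail x _ fun t ht => hle _ _ (by nlinarith)
    · have h2 := lowerIntegral_sub_le ha (hd.const_mul (a β / d β)) hx
        fun t ht => by
          rw [← hrm t]
          exact mul_le_mul_of_nonneg_right (hle _ _ (by nlinarith [ht.1, ht.2])) (hd0 t).le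
      rw [lowerIntegral_const_mul, lowerIntegral_const_mul] at h2
      linarith

lemma GP_eq_lowerIntegral [Fintype α] {P : α → ℝ} (hVP : 0 < V P) (x : ℝ) :
    GP P x = lowerIntegral (NP P) x := by
  refine Eq.trans ?_ (setIntegral_Iic_normalPDF 0 hVP x).symm
  rw [GP, sub_zero]

lemma GPQ_eq_lowerIntegral [Fintype α] [Fintype β] {P : α → ℝ} {Q : β → ℝ} (hHP : 0 < H P)
    (hHQ : 0 < H Q) (hVQ : 0 < V Q) (b x : ℝ) :
    GPQ P Q b x = lowerIntegral (NPQ P Q b) x := by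
  refine Eq.trans ?_
    (setIntegral_Iic_normalPDF (H Q * b) (by positivity : 0 < H P / H Q * V Q) x).symm
  unfold GPQ
  rw [div_eq_inv_mul (x - H Q * b), ← Real.sqrt_inv]
  congr 3
  field_simp

/-- second order asymptotics in the case `H(P)/V(P) < H(Q)/V(Q)`. -/
theorem second_order_case_lt {X Y : Type*} [Fintype X] [Fintype Y]
    (P : X → ℝ) (Q : Y → ℝ) (hP : IsProb P) (hQ : IsProb Q)
    (hVP : 0 < V P) (hVQ : 0 < V Q)
    (hratio : H P / V P < H Q / V Q) (b : ℝ) (β : ℝ)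
    (hβ : NP P β / NPQ P Q b β = (1 - GP P β) / (1 - GPQ P Q b β)) :
    Tendsto (fun n : ℕ =>
        FD (iid P n) (iid Q ⌊H P / H Q * n + b * Real.sqrt n⌋₊)) atTop
      (nhds (IPQ P Q b β + Real.sqrt ((1 - GP P β) * (1 - GPQ P Q b β)))) ∧
    Tendsto (fun n : ℕ =>
        FM (iid P n) (iid Q ⌊H P / H Q * n + b * Real.sqrt n⌋₊)) atTop
      (nhds (IPQ P Q b β + Real.sqrt ((1 - GP P β) * (1 - GPQ P Q b β)))) := by
  have hHP := H_pos hP hVP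
  have hHQ := H_pos hQ hVQ
  have hv : 0 < H P / H Q * V Q := by positivity
  have hvu : H P / H Q * V Q < V P := by
    rw [div_lt_div_iff₀ hVP hVQ] at hratio
    rw [div_mul_eq_mul_div, div_lt_iff₀ hHQ]
    linarith
  simp only [GP_eq_lowerIntegral hVP, GPQ_eq_lowerIntegral hHP hHQ hVQ] at hβ ⊢
  have hc : DensityCrossing (NP P) (NPQ P Q b) _ β :=
    densityCrossing_normalPDF (H Q * b) hv hvu hβ
  have hs : Tendsto (fun n : ℕ => √(n : ℝ)) atTop atTop :=
    Real.tendsto_sqrt_atTop.comp tendsto_natCast_atTop_atTop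
  have hA : ∀ z, Tendsto (fun n : ℕ => levelMass (iid P n) (levelSize (n * H P) √n z)) atTop
      (nhds (lowerIntegral (NP P) z)) := fun z => by
    rw [← GP_eq_lowerIntegral hVP]
    exact tendsto_levelMass_iid hP hVP z
  have hB : ∀ z, Tendsto (fun n : ℕ => levelMass (iid Q ⌊H P / H Q * n + b * √n⌋₊)
      (levelSize (n * H P) √n z)) atTop (nhds (lowerIntegral (NPQ P Q b) z)) := fun z => by
    rw [← GPQ_eq_lowerIntegral hHP hHQ hVQ]
    exact tendsto_levelMass_target hP hQ hVP hVQ b z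
  have hPn : ∀ n, IsProb (iid P n) := isProb_iid hP
  have hQn : ∀ n : ℕ, IsProb (iid Q ⌊H P / H Q * n + b * √n⌋₊) := fun n => isProb_iid hQ _
  have hlow : ∀ c < IPQ P Q b β +
      √((1 - lowerIntegral (NP P) β) * (1 - lowerIntegral (NPQ P Q b) β)),
      ∀ᶠ n : ℕ in atTop, c < FD (iid P n) (iid Q ⌊H P / H Q * n + b * √n⌋₊) := fun c h =>
    hc.eventually_lt_FD hPn hQn hs hA hB h
  have hupp : ∀ c > IPQ P Q b β +
      √((1 - lowerIntegral (NP P) β) * (1 - lowerIntegral (NPQ P Q b) β)),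
      ∀ᶠ n : ℕ in atTop, FM (iid P n) (iid Q ⌊H P / H Q * n + b * √n⌋₊) < c := fun c h => by
    obtain ⟨c', h1, h2⟩ := exists_between h
    filter_upwards [hc.eventually_FM_le hPn hQn hs hA hB h1] with n hn using hn.trans_lt h2
  refine ⟨tendsto_order.2 ⟨hlow, fun c h => ?_⟩, tendsto_order.2 ⟨fun c h => ?_, hupp⟩⟩
  · filter_upwards [hupp c h] with n hn using (FD_le_FM (hPn n) (hQn n)).trans_lt hn
  · filter_upwards [hlow c h] with n hn using hn.trans_le (FD_le_FM (hPn n) (hQn n))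

end RNG
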